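/- arXiv:2501.13323 — 2 statements merged into one kernel-verified Lean document; each statement's English description precedes it below -/
import Mathlib

section
/- Consider the sparse linear regression model with σ = 1 and all quantities k=k_n, p=p_n, μ=μ_n depending on n, asymptotics as n→∞. Assume k/p → 0, k/n → 0 and μ → 0. Then the ridge regression estimator with tuning λ = p/(kμ²) satisfies sup_{β∈Θ(k,μ)} E_β‖β̂^R(λ) − β‖₂² ≤ kμ²·(1 − kμ²/p + o(kμ²/p)); equivalently, limsup_n [ (1 − S_n/(kμ²)) · (p/(kμ²)) ]⁻¹ form: liminf_n (1 − S_n/(kμ²))·(p/(kμ²)) ≥ 1, where S_n denotes the supremum risk of β̂^R(λ) over Θ(k,μ). -/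
open MeasureTheory ProbabilityTheory Filter Matrix
open scoped NNReal ENNReal

noncomputable section

/-- Joint law of the data: a design matrix with i.i.d. `N(0, (1/n) I_p)` rows
(entries i.i.d. `N(0, 1/n)`) and an independent noise vector with i.i.d. `N(0,1)` entries. -/
def model (n p : ℕ) : Measure ((Fin n → Fin p → ℝ) × (Fin n → ℝ)) :=
  (Measure.pi fun _ : Fin n => Measure.pi fun _ : Fin p => gaussianReal 0 (n : ℝ≥0)⁻¹).prod
    (Measure.pi fun _ : Fin n => gaussianReal 0 1)

/-- Expected squared-error risk `E_β ‖est(X, Xβ + σ z) − β‖₂²` of an estimator `est`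
under the true parameter `β` and noise level `σ`. -/
def risk (n p : ℕ) (σ : ℝ)
    (est : (Fin n → Fin p → ℝ) × (Fin n → ℝ) → Fin p → ℝ) (β : Fin p → ℝ) : ℝ≥0∞ :=
  ∫⁻ ω, ENNReal.ofReal
      (∑ j, (est (ω.1, fun i => (∑ l, ω.1 i l * β l) + σ * ω.2 i) j - β j) ^ 2) ∂ model n p

/-- The `ℓ₀` norm: number of nonzero coordinates. -/
def l0norm {p : ℕ} (β : Fin p → ℝ) : ℕ := (Finset.univ.filter fun j => β j ≠ 0).card

/-- The SNR-aware sparse parameter space `Θ(k, τ)`. -/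
def Theta (p k : ℕ) (τ : ℝ) : Set (Fin p → ℝ) :=
  {β | l0norm β ≤ k ∧ ∑ j, β j ^ 2 ≤ k * τ ^ 2}

/-- The minimax risk `R(Θ(k,τ), σ)`: infimum over measurable estimators of the supremum
risk over `Θ(k,τ)`. -/
def minimaxRisk (n p k : ℕ) (τ σ : ℝ) : ℝ≥0∞ :=
  ⨅ (est : (Fin n → Fin p → ℝ) × (Fin n → ℝ) → Fin p → ℝ) (_ : Measurable est),
    ⨆ β ∈ Theta p k τ, risk n p σ est β

/-- The ridge regression estimator `β̂^R(λ) = (XᵀX + λ I_p)⁻¹ Xᵀ y`. -/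
def ridgeEst (n p : ℕ) (lam : ℝ)
    (ω : (Fin n → Fin p → ℝ) × (Fin n → ℝ)) : Fin p → ℝ :=
  ((Matrix.of ω.1)ᵀ * Matrix.of ω.1 + lam • (1 : Matrix (Fin p) (Fin p) ℝ))⁻¹ *ᵥ
    ((Matrix.of ω.1)ᵀ *ᵥ ω.2)

/-- Fourth moment of the standard Gaussian. -/
def gaussianFourthMoment : ℝ := ∫ x, x ^ 4 ∂gaussianReal 0 1

lemma gaussianFourthMoment_nonneg : 0 ≤ gaussianFourthMoment :=
  integral_nonneg fun x => by positivity

lemma integral_pow_four_gaussianReal (w : ℝ≥0) :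
    ∫ x, x ^ 4 ∂gaussianReal 0 w = gaussianFourthMoment * (w : ℝ) ^ 2 := by
  have h : gaussianReal 0 w = (gaussianReal 0 1).map (fun x => √(w : ℝ) * x) := by
    rw [gaussianReal_map_const_mul]
    congr 1
    · simp
    · ext
      simp [Real.sq_sqrt]
  rw [h, integral_map (by fun_prop) (by fun_prop), gaussianFourthMoment, mul_comm,
    ← integral_const_mul]
  congr 1
  ext x
  have : √(w : ℝ) ^ 4 = (w : ℝ) ^ 2 := by
    rw [show 4 = 2 * 2 from rfl, pow_mul, Real.sq_sqrt (NNReal.coe_nonneg w)]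
  rw [mul_pow, this]

lemma dotProduct_self_nonneg_real {ι : Type*} [Fintype ι] (w : ι → ℝ) : 0 ≤ w ⬝ᵥ w :=
  Finset.sum_nonneg fun _ _ => mul_self_nonneg _

section GaussianProduct

variable {ι : Type*} [Fintype ι] (v : ℝ≥0)

lemma hasGaussianLaw_dotProduct (a : ι → ℝ) :
    HasGaussianLaw (fun x : ι → ℝ => a ⬝ᵥ x) (Measure.pi fun _ => gaussianReal 0 v) := by
  have h : iIndepFun (fun (i : ι) (x : ι → ℝ) => x i) (Measure.pi fun _ => gaussianReal 0 v) :=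
    iIndepFun_pi (X := fun _ x => x) fun _ => by fun_prop
  have h1 : ∀ i : ι, HasGaussianLaw (fun x : ι → ℝ => x i)
      (Measure.pi fun _ => gaussianReal 0 v) := fun i =>
    ⟨by rw [(measurePreserving_eval (fun _ : ι => gaussianReal 0 v) i).map_eq]; infer_instance⟩
  have h2 := (h.hasGaussianLaw h1).map_fun
    (∑ i, a i • ContinuousLinearMap.proj (R := ℝ) (φ := fun _ : ι => ℝ) i)
  simpa [dotProduct] using h2

lemma map_dotProduct_gaussian (a : ι → ℝ) :
    (Measure.pi fun _ : ι => gaussianReal 0 v).map (fun x => a ⬝ᵥ x) =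
      gaussianReal 0 (v * (a ⬝ᵥ a).toNNReal) := by
  rw [(hasGaussianLaw_dotProduct v a).map_eq_gaussianReal]
  congr 1
  · simp only [dotProduct]
    rw [integral_finsetSum _ fun i _ => (integrable_eval IsGaussian.integrable_id).const_mul _]
    have h0 : ∀ i, ∫ x : ι → ℝ, x i ∂(Measure.pi fun _ : ι => gaussianReal 0 v) = 0 := fun i =>
      (integral_eval (μ := fun _ : ι => gaussianReal 0 v)).trans integral_id_gaussianReal
    simp [integral_const_mul, h0]
  · have h : (fun x : ι → ℝ => a ⬝ᵥ x) = ∑ i, fun x : ι → ℝ => a i * x i := by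
      ext x; simp [dotProduct]
    rw [h, variance_sum_pi (X := fun i x => a i * x)
      fun i => IsGaussian.memLp_two_id.const_mul _]
    have h0 : 0 ≤ a ⬝ᵥ a := dotProduct_self_nonneg_real a
    have hvar : ∀ i, Var[fun x => a i * x; gaussianReal 0 v] = a i ^ 2 * v := fun i =>
      (variance_const_mul _ id _).trans (by rw [variance_id_gaussianReal])
    ext
    simp_rw [hvar]
    rw [← Finset.sum_mul, NNReal.coe_mul, Real.coe_toNNReal _ h0, Real.coe_toNNReal]
    · simp [dotProduct, pow_two, mul_comm]
    · positivity

lemma memLp_dotProduct (a : ι → ℝ) (q : ℝ≥0∞) (hq : q ≠ ∞) :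
    MemLp (fun x : ι → ℝ => a ⬝ᵥ x) q (Measure.pi fun _ => gaussianReal 0 v) :=
  (hasGaussianLaw_dotProduct v a).memLp hq

lemma integral_dotProduct (a : ι → ℝ) :
    ∫ x, a ⬝ᵥ x ∂(Measure.pi fun _ : ι => gaussianReal 0 v) = 0 := by
  have := integral_map (μ := Measure.pi fun _ : ι => gaussianReal 0 v)
    (hasGaussianLaw_dotProduct v a).aemeasurable (f := fun y => y) (by fun_prop)
  rw [← this, map_dotProduct_gaussian, integral_id_gaussianReal]

lemma integrable_dotProduct_sq (a : ι → ℝ) :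
    Integrable (fun x => (a ⬝ᵥ x) ^ 2) (Measure.pi fun _ : ι => gaussianReal 0 v) :=
  (memLp_dotProduct v a 2 (by simp)).integrable_sq

lemma integral_dotProduct_sq (a : ι → ℝ) :
    ∫ x, (a ⬝ᵥ x) ^ 2 ∂(Measure.pi fun _ : ι => gaussianReal 0 v) = v * (a ⬝ᵥ a) := by
  have h0 : 0 ≤ a ⬝ᵥ a := dotProduct_self_nonneg_real a
  have h1 := variance_of_integral_eq_zero (hasGaussianLaw_dotProduct v a).aemeasurable
    (integral_dotProduct v a)
  rw [← h1, ← Function.id_comp (fun x : ι → ℝ => a ⬝ᵥ x),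
    ← variance_map (by fun_prop) (hasGaussianLaw_dotProduct v a).aemeasurable,
    map_dotProduct_gaussian, variance_id_gaussianReal]
  simp [Real.coe_toNNReal _ h0]

lemma integrable_dotProduct_pow_four (a : ι → ℝ) :
    Integrable (fun x => (a ⬝ᵥ x) ^ 4) (Measure.pi fun _ : ι => gaussianReal 0 v) := by
  have h := (memLp_dotProduct v a 4 (by simp)).integrable_norm_pow (by simp)
  refine h.congr (ae_of_all _ fun x => ?_)
  simp [Even.pow_abs (show Even 4 by decide)]

lemma integral_dotProduct_pow_four (a : ι → ℝ) :
    ∫ x, (a ⬝ᵥ x) ^ 4 ∂(Measure.pi fun _ : ι => gaussianReal 0 v) =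
      gaussianFourthMoment * (v * (a ⬝ᵥ a)) ^ 2 := by
  have h0 : 0 ≤ a ⬝ᵥ a := dotProduct_self_nonneg_real a
  have := integral_map (μ := Measure.pi fun _ : ι => gaussianReal 0 v)
    (hasGaussianLaw_dotProduct v a).aemeasurable (f := fun y => y ^ 4) (by fun_prop)
  rw [← this, map_dotProduct_gaussian, integral_pow_four_gaussianReal]
  simp [Real.coe_toNNReal _ h0]

lemma integral_dotProduct_mul_dotProduct (a b : ι → ℝ) :
    ∫ x, (a ⬝ᵥ x) * (b ⬝ᵥ x) ∂(Measure.pi fun _ : ι => gaussianReal 0 v) = v * (a ⬝ᵥ b) := by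
  have h : ∀ x, (a ⬝ᵥ x) * (b ⬝ᵥ x) = (((a + b) ⬝ᵥ x) ^ 2 - ((a - b) ⬝ᵥ x) ^ 2) / 4 := by
    intro x
    rw [add_dotProduct, sub_dotProduct]
    ring
  simp_rw [h]
  rw [integral_div, integral_sub (integrable_dotProduct_sq v _) (integrable_dotProduct_sq v _),
    integral_dotProduct_sq, integral_dotProduct_sq]
  simp only [add_dotProduct, sub_dotProduct, dotProduct_add, dotProduct_sub, dotProduct_comm b a]
  ring

lemma memLp_dotProduct_mul_dotProduct (a b : ι → ℝ) :
    MemLp (fun x => (a ⬝ᵥ x) * (b ⬝ᵥ x)) 2 (Measure.pi fun _ : ι => gaussianReal 0 v) :=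
  haveI : ENNReal.HolderTriple 4 4 2 := ⟨by
    rw [← two_mul, show (4 : ℝ≥0∞) = 2 * 2 by norm_num, ENNReal.mul_inv (by simp) (by simp),
      ← mul_assoc, ENNReal.mul_inv_cancel (by simp) (by simp), one_mul]⟩
  (memLp_dotProduct v b 4 (by simp)).mul (memLp_dotProduct v a 4 (by simp))

lemma integral_dotProduct_mul_dotProduct_sq_le (a b : ι → ℝ) :
    ∫ x, ((a ⬝ᵥ x) * (b ⬝ᵥ x)) ^ 2 ∂(Measure.pi fun _ : ι => gaussianReal 0 v) ≤
      gaussianFourthMoment * (v : ℝ) ^ 2 * ((a ⬝ᵥ a) * (b ⬝ᵥ b)) := by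
  have hb0 : 0 ≤ b ⬝ᵥ b := dotProduct_self_nonneg_real b
  have ha0 : 0 ≤ a ⬝ᵥ a := dotProduct_self_nonneg_real a
  rcases ha0.eq_or_lt with ha | ha
  · simp [dotProduct_self_eq_zero.1 ha.symm]
  rcases hb0.eq_or_lt with hb | hb
  · simp [dotProduct_self_eq_zero.1 hb.symm]
  set s := (b ⬝ᵥ b) / (a ⬝ᵥ a) with hs
  have hs0 : 0 < s := div_pos hb ha
  calc ∫ x, ((a ⬝ᵥ x) * (b ⬝ᵥ x)) ^ 2 ∂(Measure.pi fun _ : ι => gaussianReal 0 v)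
      ≤ ∫ x, (s / 2 * (a ⬝ᵥ x) ^ 4 + 1 / (2 * s) * (b ⬝ᵥ x) ^ 4)
          ∂(Measure.pi fun _ : ι => gaussianReal 0 v) := by
        refine integral_mono (memLp_dotProduct_mul_dotProduct v a b).integrable_sq
          (((integrable_dotProduct_pow_four v a).const_mul _).add
            ((integrable_dotProduct_pow_four v b).const_mul _)) fun x => ?_
        have h : s / 2 * (a ⬝ᵥ x) ^ 4 + 1 / (2 * s) * (b ⬝ᵥ x) ^ 4
            - ((a ⬝ᵥ x) * (b ⬝ᵥ x)) ^ 2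
            = 1 / (2 * s) * (s * (a ⬝ᵥ x) ^ 2 - (b ⬝ᵥ x) ^ 2) ^ 2 := by
          field_simp
          ring
        have h2 : 0 ≤ 1 / (2 * s) * (s * (a ⬝ᵥ x) ^ 2 - (b ⬝ᵥ x) ^ 2) ^ 2 := by positivity
        simp only
        linarith
    _ = gaussianFourthMoment * (v : ℝ) ^ 2 * ((a ⬝ᵥ a) * (b ⬝ᵥ b)) := by
        rw [integral_add ((integrable_dotProduct_pow_four v a).const_mul _)
            ((integrable_dotProduct_pow_four v b).const_mul _), integral_const_mul,
          integral_const_mul, integral_dotProduct_pow_four, integral_dotProduct_pow_four, hs]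
        field_simp
        ring

lemma integrable_const_add_dotProduct_sq (c : ℝ) (a : ι → ℝ) :
    Integrable (fun x => (c + a ⬝ᵥ x) ^ 2) (Measure.pi fun _ : ι => gaussianReal 0 v) :=
  ((memLp_const c).add (memLp_dotProduct v a 2 (by simp))).integrable_sq

lemma integral_const_add_dotProduct_sq (c : ℝ) (a : ι → ℝ) :
    ∫ x, (c + a ⬝ᵥ x) ^ 2 ∂(Measure.pi fun _ : ι => gaussianReal 0 v) =
      c ^ 2 + v * (a ⬝ᵥ a) := by
  have h : ∀ x, (c + a ⬝ᵥ x) ^ 2 = (c ^ 2 + 2 * c * (a ⬝ᵥ x)) + (a ⬝ᵥ x) ^ 2 := by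
    intro x; ring
  have hi : Integrable (fun x => a ⬝ᵥ x) (Measure.pi fun _ : ι => gaussianReal 0 v) :=
    (hasGaussianLaw_dotProduct v a).integrable
  simp_rw [h]
  have hi2 : Integrable (fun x => c ^ 2 + 2 * c * (a ⬝ᵥ x))
      (Measure.pi fun _ : ι => gaussianReal 0 v) := (integrable_const _).add (hi.const_mul _)
  rw [integral_add hi2 (integrable_dotProduct_sq v a),
    integral_add (integrable_const _) (hi.const_mul _), integral_const_mul,
    integral_dotProduct, integral_dotProduct_sq]
  simp

end GaussianProduct

/-- Second moment of a sum of i.i.d. variables, bounded through their first two moments. -/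
lemma integral_sum_sq_pi_le {Ω : Type*} [MeasurableSpace Ω] (ν : Measure Ω)
    [IsProbabilityMeasure ν] (n : ℕ) {Y : Ω → ℝ} (hY : MemLp Y 2 ν) :
    Integrable (fun ω : Fin n → Ω => (∑ i, Y (ω i)) ^ 2) (Measure.pi fun _ => ν) ∧
    ∫ ω : Fin n → Ω, (∑ i, Y (ω i)) ^ 2 ∂(Measure.pi fun _ => ν) ≤
      n * ∫ x, Y x ^ 2 ∂ν + (n * ∫ x, Y x ∂ν) ^ 2 := by
  have hmem : ∀ i : Fin n, MemLp (fun ω : Fin n → Ω => Y (ω i)) 2 (Measure.pi fun _ => ν) :=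
    fun i => hY.comp_measurePreserving (measurePreserving_eval (fun _ => ν) i)
  have hsum : MemLp (∑ i, fun ω : Fin n → Ω => Y (ω i)) 2 (Measure.pi fun _ => ν) :=
    memLp_finsetSum' _ fun i _ => hmem i
  have hfun : (∑ i, fun ω : Fin n → Ω => Y (ω i)) = fun ω => ∑ i, Y (ω i) := by
    ext ω; simp
  have hvar := variance_sum_pi (μ := fun _ : Fin n => ν) (X := fun _ => Y) fun _ => hY
  rw [variance_eq_sub hsum, hfun] at hvar
  rw [hfun] at hsum
  refine ⟨hsum.integrable_sq, ?_⟩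
  have hmean : ∫ ω : Fin n → Ω, ∑ i, Y (ω i) ∂(Measure.pi fun _ => ν) = n * ∫ x, Y x ∂ν := by
    rw [integral_finsetSum _ fun i _ => (hmem i).integrable (by simp)]
    have h0 : ∀ i : Fin n, ∫ ω : Fin n → Ω, Y (ω i) ∂(Measure.pi fun _ => ν) = ∫ x, Y x ∂ν :=
      fun i => integral_comp_eval (μ := fun _ : Fin n => ν) hY.aestronglyMeasurable
    simp [h0]
  have hle : Var[Y; ν] ≤ ∫ x, Y x ^ 2 ∂ν := variance_le_expectation_sq hY.aestronglyMeasurable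
  simp only [Pi.pow_apply, hmean, Finset.sum_const, Finset.card_univ, Fintype.card_fin,
    nsmul_eq_mul] at hvar
  have : (n : ℝ) * Var[Y; ν] ≤ n * ∫ x, Y x ^ 2 ∂ν := by gcongr
  linarith

section Ridge

variable {n p : ℕ}

lemma dotProduct_transpose_mulVec_real (X : Matrix (Fin n) (Fin p) ℝ) (w : Fin p → ℝ)
    (u : Fin n → ℝ) : w ⬝ᵥ (Xᵀ *ᵥ u) = (X *ᵥ w) ⬝ᵥ u := by
  rw [dotProduct_mulVec, vecMul_transpose]

lemma ridge_shrinkage_bounds (X : Matrix (Fin n) (Fin p) ℝ) (w β : Fin p → ℝ) {c : ℝ}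
    (hc : 0 ≤ c) (h : β = w + c • (Xᵀ *ᵥ (X *ᵥ w))) :
    β ⬝ᵥ β - 2 * c * ((X *ᵥ β) ⬝ᵥ (X *ᵥ β)) ≤ w ⬝ᵥ w ∧
    w ⬝ᵥ w ≤ β ⬝ᵥ β - 2 * c * ((X *ᵥ β) ⬝ᵥ (X *ᵥ β)) +
      3 * c ^ 2 * ((Xᵀ *ᵥ (X *ᵥ β)) ⬝ᵥ (Xᵀ *ᵥ (X *ᵥ β))) := by
  set w₁ := Xᵀ *ᵥ (X *ᵥ w) with hw₁
  set w₂ := Xᵀ *ᵥ (X *ᵥ w₁) with hw₂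
  have e1 : w ⬝ᵥ w₁ = (X *ᵥ w) ⬝ᵥ (X *ᵥ w) := dotProduct_transpose_mulVec_real X w _
  have e2 : w ⬝ᵥ w₂ = w₁ ⬝ᵥ w₁ := by
    rw [hw₂, dotProduct_transpose_mulVec_real, dotProduct_comm,
      ← dotProduct_transpose_mulVec_real]
  have e3 : w₁ ⬝ᵥ w₂ = (X *ᵥ w₁) ⬝ᵥ (X *ᵥ w₁) := dotProduct_transpose_mulVec_real X w₁ _
  have hXβ : X *ᵥ β = X *ᵥ w + c • (X *ᵥ w₁) := by rw [h, mulVec_add, mulVec_smul]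
  have hHβ : Xᵀ *ᵥ (X *ᵥ β) = w₁ + c • w₂ := by rw [hXβ, mulVec_add, mulVec_smul]
  have e4 : (X *ᵥ w) ⬝ᵥ (X *ᵥ w₁) = w₁ ⬝ᵥ w₁ := by
    rw [← e2, hw₂, dotProduct_transpose_mulVec_real]
  have m2 := dotProduct_self_nonneg_real w₁
  have m3 := dotProduct_self_nonneg_real (X *ᵥ w₁)
  have m4 := dotProduct_self_nonneg_real w₂
  rw [hHβ, hXβ, h]
  simp only [add_dotProduct, dotProduct_add, smul_dotProduct, dotProduct_smul, smul_eq_mul,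
    dotProduct_comm w₁ w, dotProduct_comm (X *ᵥ w₁) (X *ᵥ w), dotProduct_comm w₂ w₁, e1, e3, e4]
  have h2 : 0 ≤ c ^ 2 * (w₁ ⬝ᵥ w₁) := by positivity
  have h3 : 0 ≤ c ^ 3 * ((X *ᵥ w₁) ⬝ᵥ (X *ᵥ w₁)) := by positivity
  have h4 : 0 ≤ c ^ 4 * (w₂ ⬝ᵥ w₂) := by positivity
  constructor <;> nlinarith

/-- The regularized Gram matrix `XᵀX + λ I_p`. -/
def ridgeGram (lam : ℝ) (X : Matrix (Fin n) (Fin p) ℝ) : Matrix (Fin p) (Fin p) ℝ :=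
  Xᵀ * X + lam • (1 : Matrix (Fin p) (Fin p) ℝ)

lemma isUnit_det_ridgeGram {lam : ℝ} (hlam : 0 < lam) (X : Matrix (Fin n) (Fin p) ℝ) :
    IsUnit (ridgeGram lam X).det := by
  have h1 : (Xᵀ * X).PosSemidef := by
    simpa using posSemidef_conjTranspose_mul_self X
  have h2 : (lam • (1 : Matrix (Fin p) (Fin p) ℝ)).PosDef := PosDef.one.smul hlam
  exact (h2.posSemidef_add h1).det_pos.ne'.isUnit

lemma continuous_inv_ridgeGram {lam : ℝ} (hlam : 0 < lam) :
    Continuous fun X : Matrix (Fin n) (Fin p) ℝ => (ridgeGram lam X)⁻¹ := by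
  have hc : Continuous fun X : Matrix (Fin n) (Fin p) ℝ => ridgeGram lam X := by
    unfold ridgeGram
    fun_prop
  simp_rw [inv_def, Ring.inverse_eq_inv']
  exact (hc.matrix_det.inv₀ fun X => (isUnit_det_ridgeGram hlam X).ne_zero).smul
    hc.matrix_adjugate

lemma mulVec_ridgeGram (lam : ℝ) (X : Matrix (Fin n) (Fin p) ℝ) (w : Fin p → ℝ) :
    ridgeGram lam X *ᵥ w = Xᵀ *ᵥ (X *ᵥ w) + lam • w := by
  simp [ridgeGram, add_mulVec, smul_mulVec]

lemma mulVec_inv_ridgeGram {lam : ℝ} (hlam : 0 < lam) (X : Matrix (Fin n) (Fin p) ℝ)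
    (u : Fin p → ℝ) :
    Xᵀ *ᵥ (X *ᵥ ((ridgeGram lam X)⁻¹ *ᵥ u)) + lam • ((ridgeGram lam X)⁻¹ *ᵥ u) = u := by
  rw [← mulVec_ridgeGram, mulVec_mulVec, mul_nonsing_inv _ (isUnit_det_ridgeGram hlam X),
    one_mulVec]

/-- The bias vector (up to sign) of the ridge estimator at `β`, conditionally on the design. -/
def ridgeBias (lam : ℝ) (X : Matrix (Fin n) (Fin p) ℝ) (β : Fin p → ℝ) : Fin p → ℝ :=
  lam • ((ridgeGram lam X)⁻¹ *ᵥ β)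

/-- The conditional variance of the ridge estimator given the design. -/
def ridgeVariance (lam : ℝ) (X : Matrix (Fin n) (Fin p) ℝ) : ℝ :=
  ∑ j, ((ridgeGram lam X)⁻¹ * Xᵀ) j ⬝ᵥ ((ridgeGram lam X)⁻¹ * Xᵀ) j

lemma ridgeBias_bounds {lam : ℝ} (hlam : 0 < lam) (X : Matrix (Fin n) (Fin p) ℝ)
    (β : Fin p → ℝ) :
    β ⬝ᵥ β - 2 * lam⁻¹ * ((X *ᵥ β) ⬝ᵥ (X *ᵥ β)) ≤ ridgeBias lam X β ⬝ᵥ ridgeBias lam X β ∧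
    ridgeBias lam X β ⬝ᵥ ridgeBias lam X β ≤
      β ⬝ᵥ β - 2 * lam⁻¹ * ((X *ᵥ β) ⬝ᵥ (X *ᵥ β)) +
      3 * lam⁻¹ ^ 2 * ((Xᵀ *ᵥ (X *ᵥ β)) ⬝ᵥ (Xᵀ *ᵥ (X *ᵥ β))) := by
  refine ridge_shrinkage_bounds X _ β (inv_nonneg.2 hlam.le) ?_
  conv_lhs => rw [← mulVec_inv_ridgeGram hlam X β]
  rw [ridgeBias, mulVec_smul, mulVec_smul, smul_smul, inv_mul_cancel₀ hlam.ne', one_smul,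
    add_comm]

lemma ridgeVariance_nonneg (lam : ℝ) (X : Matrix (Fin n) (Fin p) ℝ) :
    0 ≤ ridgeVariance lam X :=
  Finset.sum_nonneg fun _ _ => dotProduct_self_nonneg_real _

lemma ridgeVariance_le {lam : ℝ} (hlam : 0 < lam) (X : Matrix (Fin n) (Fin p) ℝ) :
    ridgeVariance lam X ≤ lam⁻¹ ^ 2 * ∑ i, X i ⬝ᵥ X i := by
  have key : ∀ i, ((ridgeGram lam X)⁻¹ *ᵥ X i) ⬝ᵥ ((ridgeGram lam X)⁻¹ *ᵥ X i) ≤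
      lam⁻¹ ^ 2 * (X i ⬝ᵥ X i) := by
    intro i
    have h := mulVec_inv_ridgeGram hlam X (X i)
    set w := (ridgeGram lam X)⁻¹ *ᵥ X i
    have e1 : w ⬝ᵥ (Xᵀ *ᵥ (X *ᵥ w)) = (X *ᵥ w) ⬝ᵥ (X *ᵥ w) :=
      dotProduct_transpose_mulVec_real X w _
    have h1 := dotProduct_self_nonneg_real (X *ᵥ w)
    have h2 := dotProduct_self_nonneg_real (Xᵀ *ᵥ (X *ᵥ w))
    have h3 : lam ^ 2 * (w ⬝ᵥ w) ≤ X i ⬝ᵥ X i := by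
      rw [← h]
      simp only [add_dotProduct, dotProduct_add, smul_dotProduct, dotProduct_smul, smul_eq_mul,
        dotProduct_comm (Xᵀ *ᵥ (X *ᵥ w)) w, e1]
      have : 0 ≤ lam * ((X *ᵥ w) ⬝ᵥ (X *ᵥ w)) := by positivity
      nlinarith
    rw [inv_pow, inv_mul_eq_div, le_div_iff₀ (by positivity)]
    linarith
  have hswap : ridgeVariance lam X =
      ∑ i, ((ridgeGram lam X)⁻¹ *ᵥ X i) ⬝ᵥ ((ridgeGram lam X)⁻¹ *ᵥ X i) := by
    simp only [ridgeVariance, dotProduct, mulVec, mul_apply, transpose_apply]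
    exact Finset.sum_comm
  rw [hswap, Finset.mul_sum]
  exact Finset.sum_le_sum fun i _ => key i

lemma ridgeEst_sub {lam : ℝ} (hlam : 0 < lam) (X : Fin n → Fin p → ℝ) (z : Fin n → ℝ)
    (β : Fin p → ℝ) (j : Fin p) :
    ridgeEst n p lam (X, fun i => (∑ l, X i l * β l) + 1 * z i) j - β j =
      -ridgeBias lam (of X) β j + ((ridgeGram lam (of X))⁻¹ * (of X)ᵀ) j ⬝ᵥ z := by
  have hy : (fun i => (∑ l, X i l * β l) + 1 * z i) = of X *ᵥ β + z := by
    ext i; simp [mulVec, dotProduct]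
  have hG : (of X)ᵀ *ᵥ (of X *ᵥ β) = ridgeGram lam (of X) *ᵥ β - lam • β := by
    rw [mulVec_ridgeGram, add_sub_cancel_right]
  have h : ridgeEst n p lam (X, fun i => (∑ l, X i l * β l) + 1 * z i) =
      β - ridgeBias lam (of X) β + ((ridgeGram lam (of X))⁻¹ * (of X)ᵀ) *ᵥ z := by
    rw [hy]
    change (ridgeGram lam (of X))⁻¹ *ᵥ ((of X)ᵀ *ᵥ (of X *ᵥ β + z)) = _
    rw [mulVec_add, mulVec_add, hG, mulVec_sub, mulVec_mulVec, mulVec_mulVec,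
      nonsing_inv_mul _ (isUnit_det_ridgeGram hlam _), one_mulVec, mulVec_smul, ridgeBias]
  rw [h]
  simp [mulVec]
  ring

/-- Law of the design matrix. -/
abbrev designLaw (n p : ℕ) : Measure (Fin n → Fin p → ℝ) :=
  Measure.pi fun _ : Fin n => Measure.pi fun _ : Fin p => gaussianReal 0 (n : ℝ≥0)⁻¹

/-- The risk of the ridge estimator conditionally on the design. -/
def ridgeCondRisk (lam : ℝ) (β : Fin p → ℝ) (X : Fin n → Fin p → ℝ) : ℝ :=
  ridgeBias lam (of X) β ⬝ᵥ ridgeBias lam (of X) β + ridgeVariance lam (of X)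

lemma ridgeCondRisk_nonneg (lam : ℝ) (β : Fin p → ℝ) (X : Fin n → Fin p → ℝ) :
    0 ≤ ridgeCondRisk lam β X :=
  add_nonneg (dotProduct_self_nonneg_real _) (ridgeVariance_nonneg _ _)

lemma continuous_inv_ridgeGram_of {lam : ℝ} (hlam : 0 < lam) :
    Continuous fun X : Fin n → Fin p → ℝ => (ridgeGram lam (of X))⁻¹ :=
  continuous_inv_ridgeGram (n := n) (p := p) hlam

lemma continuous_ridgeBias {lam : ℝ} (hlam : 0 < lam) (β : Fin p → ℝ) :
    Continuous fun X : Fin n → Fin p → ℝ => ridgeBias lam (of X) β :=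
  ((continuous_inv_ridgeGram_of hlam).matrix_mulVec continuous_const).const_smul lam

lemma continuous_ridgeNoise {lam : ℝ} (hlam : 0 < lam) (j : Fin p) :
    Continuous fun X : Fin n → Fin p → ℝ => ((ridgeGram lam (of X))⁻¹ * (of X)ᵀ) j := by
  have h : Continuous fun X : Fin n → Fin p → ℝ => (of X)ᵀ :=
    Continuous.matrix_transpose (A := fun X : Fin n → Fin p → ℝ => of X) continuous_id
  exact (continuous_apply j).comp ((continuous_inv_ridgeGram_of hlam).matrix_mul h)

lemma continuous_ridgeCondRisk {lam : ℝ} (hlam : 0 < lam) (β : Fin p → ℝ) :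
    Continuous fun X : Fin n → Fin p → ℝ => ridgeCondRisk lam β X :=
  ((continuous_ridgeBias hlam β).dotProduct (continuous_ridgeBias hlam β)).add
    (continuous_finsetSum _ fun j _ =>
      (continuous_ridgeNoise hlam j).dotProduct (continuous_ridgeNoise hlam j))

lemma risk_ridgeEst {lam : ℝ} (hlam : 0 < lam) (β : Fin p → ℝ) :
    risk n p 1 (ridgeEst n p lam) β =
      ∫⁻ X, ENNReal.ofReal (ridgeCondRisk lam β X) ∂designLaw n p := by
  unfold risk model
  simp only [ridgeEst_sub hlam]
  rw [lintegral_prod]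
  · refine lintegral_congr fun X => ?_
    have hint : ∀ j : Fin p, Integrable (fun z : Fin n → ℝ => (-ridgeBias lam (of X) β j +
        ((ridgeGram lam (of X))⁻¹ * (of X)ᵀ) j ⬝ᵥ z) ^ 2)
        (Measure.pi fun _ : Fin n => gaussianReal 0 1) :=
      fun j => integrable_const_add_dotProduct_sq 1 _ _
    rw [← ofReal_integral_eq_lintegral_ofReal (integrable_finsetSum _ fun j _ => hint j)
      (ae_of_all _ fun z => Finset.sum_nonneg fun j _ => sq_nonneg _),
      integral_finsetSum _ fun j _ => hint j]
    congr 1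
    simp_rw [integral_const_add_dotProduct_sq]
    rw [Finset.sum_add_distrib, ridgeCondRisk, ridgeVariance]
    simp [dotProduct, pow_two]
  · refine Measurable.aemeasurable (Continuous.measurable ?_)
    refine ENNReal.continuous_ofReal.comp (continuous_finsetSum _ fun j _ => Continuous.pow ?_ 2)
    refine Continuous.add ?_ ?_
    · exact ((continuous_apply j).comp ((continuous_ridgeBias hlam β).comp continuous_fst)).neg
    · exact Continuous.dotProduct ((continuous_ridgeNoise hlam j).comp continuous_fst)
        continuous_snd

end Ridge

section Design

variable {n p : ℕ}

lemma integrable_design_sum {f : (Fin p → ℝ) → ℝ}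
    (hf : Integrable f (Measure.pi fun _ : Fin p => gaussianReal 0 (n : ℝ≥0)⁻¹)) :
    Integrable (fun X : Fin n → Fin p → ℝ => ∑ i, f (X i)) (designLaw n p) :=
  integrable_finsetSum _ fun i _ => integrable_comp_eval
    (μ := fun _ : Fin n => Measure.pi fun _ : Fin p => gaussianReal 0 (n : ℝ≥0)⁻¹) (i := i) hf

lemma integral_design_sum {f : (Fin p → ℝ) → ℝ}
    (hf : Integrable f (Measure.pi fun _ : Fin p => gaussianReal 0 (n : ℝ≥0)⁻¹)) :
    ∫ X : Fin n → Fin p → ℝ, ∑ i, f (X i) ∂designLaw n p =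
      n * ∫ x, f x ∂(Measure.pi fun _ : Fin p => gaussianReal 0 (n : ℝ≥0)⁻¹) := by
  have h (i : Fin n) : ∫ X : Fin n → Fin p → ℝ, f (X i) ∂designLaw n p =
      ∫ x, f x ∂(Measure.pi fun _ : Fin p => gaussianReal 0 (n : ℝ≥0)⁻¹) :=
    integral_comp_eval
      (μ := fun _ : Fin n => Measure.pi fun _ : Fin p => gaussianReal 0 (n : ℝ≥0)⁻¹)
      hf.aestronglyMeasurable
  rw [integral_finsetSum _ fun i _ => integrable_comp_eval
    (μ := fun _ : Fin n => Measure.pi fun _ : Fin p => gaussianReal 0 (n : ℝ≥0)⁻¹) (i := i) hf]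
  simp [h]

lemma mulVec_dotProduct_self_eq_sum (X : Fin n → Fin p → ℝ) (β : Fin p → ℝ) :
    (of X *ᵥ β) ⬝ᵥ (of X *ᵥ β) = ∑ i, (β ⬝ᵥ X i) ^ 2 := by
  simp [dotProduct, mulVec, pow_two, mul_comm]

lemma integrable_design_mulVec (β : Fin p → ℝ) :
    Integrable (fun X => (of X *ᵥ β) ⬝ᵥ (of X *ᵥ β)) (designLaw n p) := by
  simp_rw [mulVec_dotProduct_self_eq_sum]
  exact integrable_design_sum (integrable_dotProduct_sq _ β)

lemma integral_design_mulVec (hn : 0 < n) (β : Fin p → ℝ) :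
    ∫ X, (of X *ᵥ β) ⬝ᵥ (of X *ᵥ β) ∂designLaw n p = β ⬝ᵥ β := by
  simp_rw [mulVec_dotProduct_self_eq_sum]
  rw [integral_design_sum (integrable_dotProduct_sq _ β), integral_dotProduct_sq]
  have : (n : ℝ) ≠ 0 := by positivity
  simp [this]

lemma dotProduct_self_eq_sum_single (x : Fin p → ℝ) :
    x ⬝ᵥ x = ∑ j, (Pi.single j 1 ⬝ᵥ x) ^ 2 := by
  simp [dotProduct, pow_two, Pi.single_apply]

lemma integrable_row_dotProduct_self :
    Integrable (fun x : Fin p → ℝ => x ⬝ᵥ x)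
      (Measure.pi fun _ : Fin p => gaussianReal 0 (n : ℝ≥0)⁻¹) := by
  simp_rw [dotProduct_self_eq_sum_single]
  exact integrable_finsetSum _ fun j _ => integrable_dotProduct_sq _ _

lemma integral_design_frobenius (hn : 0 < n) :
    ∫ X, ∑ i, X i ⬝ᵥ X i ∂designLaw n p = p := by
  have h : ∫ x : Fin p → ℝ, x ⬝ᵥ x ∂(Measure.pi fun _ : Fin p => gaussianReal 0 (n : ℝ≥0)⁻¹) =
      p * (n : ℝ)⁻¹ := by
    simp_rw [dotProduct_self_eq_sum_single]
    rw [integral_finsetSum _ fun j _ => integrable_dotProduct_sq _ _]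
    simp_rw [integral_dotProduct_sq]
    simp
  rw [integral_design_sum integrable_row_dotProduct_self, h]
  have : (n : ℝ) ≠ 0 := by positivity
  field_simp

lemma gram_mulVec_dotProduct_self_eq_sum (X : Fin n → Fin p → ℝ) (β : Fin p → ℝ) :
    ((of X)ᵀ *ᵥ (of X *ᵥ β)) ⬝ᵥ ((of X)ᵀ *ᵥ (of X *ᵥ β)) =
      ∑ j, (∑ i, (Pi.single j 1 ⬝ᵥ X i) * (β ⬝ᵥ X i)) ^ 2 := by
  have h : ∀ j, ((of X)ᵀ *ᵥ (of X *ᵥ β)) j = ∑ i, (Pi.single j 1 ⬝ᵥ X i) * (β ⬝ᵥ X i) := by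
    intro j
    rw [mulVec, dotProduct]
    refine Finset.sum_congr rfl fun i _ => ?_
    rw [single_one_dotProduct, mulVec, dotProduct_comm β]
    rfl
  rw [dotProduct]
  simp_rw [h, pow_two]

lemma integrable_design_gram (β : Fin p → ℝ) :
    Integrable (fun X => ((of X)ᵀ *ᵥ (of X *ᵥ β)) ⬝ᵥ ((of X)ᵀ *ᵥ (of X *ᵥ β)))
      (designLaw n p) := by
  simp_rw [gram_mulVec_dotProduct_self_eq_sum]
  exact integrable_finsetSum _ fun j _ =>
    (integral_sum_sq_pi_le _ n (memLp_dotProduct_mul_dotProduct _ (Pi.single j 1) β)).1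

lemma integral_design_gram_le (hn : 0 < n) (β : Fin p → ℝ) :
    ∫ X, ((of X)ᵀ *ᵥ (of X *ᵥ β)) ⬝ᵥ ((of X)ᵀ *ᵥ (of X *ᵥ β)) ∂designLaw n p ≤
      (1 + gaussianFourthMoment * (p / n)) * (β ⬝ᵥ β) := by
  have hn' : (n : ℝ) ≠ 0 := by positivity
  simp_rw [gram_mulVec_dotProduct_self_eq_sum]
  rw [integral_finsetSum _ fun j _ =>
    (integral_sum_sq_pi_le _ n (memLp_dotProduct_mul_dotProduct _ (Pi.single j 1) β)).1]
  calc _ ≤ ∑ j : Fin p, (gaussianFourthMoment / n * (β ⬝ᵥ β) + β j ^ 2) := by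
        refine Finset.sum_le_sum fun j _ => ?_
        refine (integral_sum_sq_pi_le _ n
          (memLp_dotProduct_mul_dotProduct _ (Pi.single j 1) β)).2.trans ?_
        have h := integral_dotProduct_mul_dotProduct_sq_le (n : ℝ≥0)⁻¹ (Pi.single j 1) β
        rw [integral_dotProduct_mul_dotProduct]
        simp only [single_one_dotProduct, Pi.single_eq_same, one_mul, NNReal.coe_inv,
          NNReal.coe_natCast] at h ⊢
        rw [mul_inv_cancel_left₀ hn']
        have h2 := mul_le_mul_of_nonneg_left h (Nat.cast_nonneg (α := ℝ) n)
        have h3 : (n : ℝ) * (gaussianFourthMoment * (n : ℝ)⁻¹ ^ 2 * (β ⬝ᵥ β)) =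
            gaussianFourthMoment / n * (β ⬝ᵥ β) := by
          field_simp
        linarith
    _ = (1 + gaussianFourthMoment * (p / n)) * (β ⬝ᵥ β) := by
        rw [Finset.sum_add_distrib]
        simp only [dotProduct, Finset.sum_const, Finset.card_univ, Fintype.card_fin,
          nsmul_eq_mul, pow_two]
        ring

lemma ridge_risk_bounds (hn : 0 < n) {lam : ℝ} (hlam : 0 < lam) (β : Fin p → ℝ) :
    ENNReal.ofReal ((1 - 2 * lam⁻¹) * (β ⬝ᵥ β)) ≤ risk n p 1 (ridgeEst n p lam) β ∧
    risk n p 1 (ridgeEst n p lam) β ≤ ENNReal.ofReal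
      ((1 - 2 * lam⁻¹ + 3 * lam⁻¹ ^ 2 * (1 + gaussianFourthMoment * (p / n))) * (β ⬝ᵥ β) +
        lam⁻¹ ^ 2 * p) := by
  have hi1 := (integrable_design_mulVec (n := n) β).const_mul (2 * lam⁻¹)
  have hi2 := (integrable_design_gram (n := n) β).const_mul (3 * lam⁻¹ ^ 2)
  have hi3 := (integrable_design_sum (integrable_row_dotProduct_self (n := n) (p := p))).const_mul
    (lam⁻¹ ^ 2)
  have hlow : Integrable (fun X => β ⬝ᵥ β - 2 * lam⁻¹ * ((of X *ᵥ β) ⬝ᵥ (of X *ᵥ β)))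
      (designLaw n p) := (integrable_const _).sub hi1
  have hmid := hlow.add hi2
  have hup := hmid.add hi3
  have hle : ∀ X : Fin n → Fin p → ℝ, ridgeCondRisk lam β X ≤
      β ⬝ᵥ β - 2 * lam⁻¹ * ((of X *ᵥ β) ⬝ᵥ (of X *ᵥ β)) +
        3 * lam⁻¹ ^ 2 * (((of X)ᵀ *ᵥ (of X *ᵥ β)) ⬝ᵥ ((of X)ᵀ *ᵥ (of X *ᵥ β))) +
        lam⁻¹ ^ 2 * ∑ i, X i ⬝ᵥ X i := fun X =>
    add_le_add (ridgeBias_bounds hlam (of X) β).2 (ridgeVariance_le hlam (of X))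
  have hint : Integrable (fun X => ridgeCondRisk lam β X) (designLaw n p) :=
    hup.mono' (continuous_ridgeCondRisk hlam β).aestronglyMeasurable
      (ae_of_all _ fun X => by
        rw [Real.norm_of_nonneg (ridgeCondRisk_nonneg lam β X)]
        exact hle X)
  have hlowint : ∫ X, (β ⬝ᵥ β - 2 * lam⁻¹ * ((of X *ᵥ β) ⬝ᵥ (of X *ᵥ β))) ∂designLaw n p =
      (1 - 2 * lam⁻¹) * (β ⬝ᵥ β) := by
    rw [integral_sub (integrable_const _) hi1, integral_const_mul, integral_design_mulVec hn]
    simp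
    ring
  rw [risk_ridgeEst hlam, ← ofReal_integral_eq_lintegral_ofReal hint
    (ae_of_all _ fun X => ridgeCondRisk_nonneg lam β X)]
  constructor <;> refine ENNReal.ofReal_le_ofReal ?_
  · rw [← hlowint]
    refine integral_mono hlow hint fun X => ?_
    have h1 := (ridgeBias_bounds hlam (of X) β).1
    have h2 := ridgeVariance_nonneg lam (of X)
    simp only [ridgeCondRisk]
    linarith
  · refine (integral_mono hint hup hle).trans ?_
    simp only [Pi.add_apply]
    rw [integral_add (by exact hmid) hi3, integral_add hlow hi2, hlowint, integral_const_mul,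
      integral_const_mul, integral_design_frobenius hn]
    have h := mul_le_mul_of_nonneg_left (integral_design_gram_le (p := p) hn β)
      (show 0 ≤ 3 * lam⁻¹ ^ 2 by positivity)
    linarith

/-- Two-sided bounds on the supremum risk of ridge regression over `Θ(k, τ)`. -/
lemma iSup_ridge_risk_bounds (hn : 0 < n) {k : ℕ} (hk : 0 < k) (hp : 0 < p) {τ : ℝ} {lam : ℝ}
    (hlam : 0 < lam) :
    (1 - 2 * lam⁻¹) * (k * τ ^ 2) ≤
        (⨆ β ∈ Theta p k τ, risk n p 1 (ridgeEst n p lam) β).toReal ∧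
    (⨆ β ∈ Theta p k τ, risk n p 1 (ridgeEst n p lam) β).toReal ≤
      (1 - 2 * lam⁻¹ + 3 * lam⁻¹ ^ 2 * (1 + gaussianFourthMoment * (p / n))) * (k * τ ^ 2) +
        lam⁻¹ ^ 2 * p := by
  have hκ := gaussianFourthMoment_nonneg
  have hq : 0 ≤ 3 * lam⁻¹ ^ 2 * (gaussianFourthMoment * (p / n)) := by positivity
  have hcoef : 0 ≤ 1 - 2 * lam⁻¹ + 3 * lam⁻¹ ^ 2 * (1 + gaussianFourthMoment * (p / n)) := by
    nlinarith [sq_nonneg (1 - lam⁻¹), sq_nonneg lam⁻¹]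
  have hup : (⨆ β ∈ Theta p k τ, risk n p 1 (ridgeEst n p lam) β) ≤ ENNReal.ofReal
      ((1 - 2 * lam⁻¹ + 3 * lam⁻¹ ^ 2 * (1 + gaussianFourthMoment * (p / n))) * (k * τ ^ 2) +
        lam⁻¹ ^ 2 * p) := by
    refine iSup₂_le fun β hβ => (ridge_risk_bounds hn hlam β).2.trans
      (ENNReal.ofReal_le_ofReal ?_)
    have hβ2 : β ⬝ᵥ β ≤ k * τ ^ 2 := by
      simpa [dotProduct, pow_two] using hβ.2
    gcongr
  refine ⟨?_, ENNReal.toReal_le_of_le_ofReal (by positivity) hup⟩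
  set b : Fin p → ℝ := Pi.single ⟨0, hp⟩ √(k * τ ^ 2) with hb
  have hbb : b ⬝ᵥ b = k * τ ^ 2 := by
    rw [hb, single_dotProduct, Pi.single_eq_same, Real.mul_self_sqrt (by positivity)]
  have hmem : b ∈ Theta p k τ := by
    refine ⟨le_trans (Finset.card_le_one.2 fun i hi j hj => ?_) hk, ?_⟩
    · have key : ∀ i ∈ Finset.univ.filter (fun j => b j ≠ 0), i = ⟨0, hp⟩ := fun i hi => by
        by_contra hne
        exact (Finset.mem_filter.1 hi).2 (by rw [hb, Pi.single_eq_of_ne hne])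
      rw [key i hi, key j hj]
    · rw [← hbb]
      simp [dotProduct, pow_two]
  have hlow := (ridge_risk_bounds hn hlam b).1.trans
    (le_iSup₂ (f := fun β (_ : β ∈ Theta p k τ) => risk n p 1 (ridgeEst n p lam) β) b hmem)
  rw [hbb] at hlow
  exact (ENNReal.ofReal_le_iff_le_toReal (hup.trans_lt ENNReal.ofReal_lt_top).ne).1 hlow

end Design

/-- **Theorem 3 (Regime I), ridge-optimality part (σ = 1).** If `k/p → 0`, `k/n → 0` and
`μ → 0`, the ridge estimator with tuning `λ = p/(k μ²)` has supremum risk over `Θ(k,μ)`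
at most `k μ² (1 − (k μ²/p)(1 + o(1)))`, i.e.
`liminf (1 − S_n/(k μ²)) · (p/(k μ²)) ≥ 1` where `S_n` is its supremum risk. -/
theorem ridge_optimal_regimeI
    (k p : ℕ → ℕ) (μ : ℕ → ℝ)
    (hk : ∀ n, 0 < k n) (hkp : ∀ n, k n ≤ p n) (hμpos : ∀ n, 0 < μ n)
    (hkp0 : Tendsto (fun n => (k n : ℝ) / p n) atTop (nhds 0))
    (hkn0 : Tendsto (fun n => (k n : ℝ) / n) atTop (nhds 0))
    (hμ : Tendsto (fun n => μ n) atTop (nhds 0)) :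
    1 ≤ Filter.liminf (fun n =>
        (1 - (⨆ β ∈ Theta (p n) (k n) (μ n),
            risk n (p n) 1 (ridgeEst n (p n) ((p n : ℝ) / (k n * μ n ^ 2)))
              β).toReal / (k n * μ n ^ 2)) *
          ((p n : ℝ) / (k n * μ n ^ 2))) atTop := by
  have hκ := gaussianFourthMoment_nonneg
  have hkey : ∀ n, 0 < n →
      1 - 3 * ((k n : ℝ) / p n * μ n ^ 2 + gaussianFourthMoment * ((k n : ℝ) / n * μ n ^ 2)) ≤
        (1 - (⨆ β ∈ Theta (p n) (k n) (μ n),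
            risk n (p n) 1 (ridgeEst n (p n) ((p n : ℝ) / (k n * μ n ^ 2)))
              β).toReal / (k n * μ n ^ 2)) * ((p n : ℝ) / (k n * μ n ^ 2)) ∧
      (1 - (⨆ β ∈ Theta (p n) (k n) (μ n),
            risk n (p n) 1 (ridgeEst n (p n) ((p n : ℝ) / (k n * μ n ^ 2)))
              β).toReal / (k n * μ n ^ 2)) * ((p n : ℝ) / (k n * μ n ^ 2)) ≤ 2 := by
    intro n hn
    have hp : 0 < p n := (hk n).trans_le (hkp n)
    have hp' : (0 : ℝ) < p n := by exact_mod_cast hp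
    have hk' : (0 : ℝ) < k n := by exact_mod_cast hk n
    have hn' : (0 : ℝ) < n := by exact_mod_cast hn
    have hμn := hμpos n
    have hM : (0 : ℝ) < k n * μ n ^ 2 := by positivity
    have hlam : (0 : ℝ) < (p n : ℝ) / (k n * μ n ^ 2) := by positivity
    obtain ⟨h1, h2⟩ := iSup_ridge_risk_bounds (n := n) hn (hk n) hp (τ := μ n) hlam
    set S := (⨆ β ∈ Theta (p n) (k n) (μ n),
      risk n (p n) 1 (ridgeEst n (p n) ((p n : ℝ) / (k n * μ n ^ 2))) β).toReal
    have hu : (1 - S / (k n * μ n ^ 2)) * ((p n : ℝ) / (k n * μ n ^ 2)) =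
        (k n * μ n ^ 2 - S) * (p n / (k n * μ n ^ 2) ^ 2) := by
      field_simp
    have hd : 0 ≤ (p n : ℝ) / (k n * μ n ^ 2) ^ 2 := by positivity
    rw [hu]
    rw [inv_div] at h1 h2
    constructor
    · refine le_trans (le_of_eq ?_) (mul_le_mul_of_nonneg_right (sub_le_sub_left h2 _) hd)
      field_simp
      ring
    · refine (mul_le_mul_of_nonneg_right (sub_le_sub_left h1 _) hd).trans (le_of_eq ?_)
      field_simp
      ring
  have hlim : Tendsto (fun n => 1 - 3 * ((k n : ℝ) / p n * μ n ^ 2 +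
      gaussianFourthMoment * ((k n : ℝ) / n * μ n ^ 2))) atTop (nhds 1) := by
    simpa using (((hkp0.mul (hμ.pow 2)).add
      ((hkn0.mul (hμ.pow 2)).const_mul gaussianFourthMoment)).const_mul 3).const_sub 1
  refine hlim.liminf_eq.ge.trans ?_
  refine liminf_le_liminf ?_ hlim.isBoundedUnder_ge ?_
  · filter_upwards [eventually_gt_atTop 0] with n hn using (hkey n hn).1
  · refine IsBoundedUnder.isCoboundedUnder_ge (isBoundedUnder_of_eventually_le (a := 2) ?_)
    filter_upwards [eventually_gt_atTop 0] with n hn using (hkey n hn).2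
end
end

section
/- Consider the sparse linear regression model with all quantities k=k_n, p=p_n, τ=τ_n, σ=σ_n depending on n, asymptotics as n→∞, and μ = τ/σ. Assume k/p → 0, μ → ∞, μ = o(√(log(p/k))), (log(p/k))/n → 0 and τ⁴/(nσ⁴) → 0. Then the minimax risk satisfies R(Θ(k,τ), σ) ≥ kτ²·(1 − ((1+o(1))/2)·(k/p)·e^{τ²/σ²}); equivalently, limsup_n (1 − R(Θ(k,τ),σ)/(kτ²)) · (2p/(k·e^{μ²})) ≤ 1. -/
open MeasureTheory ProbabilityTheory Filter
open scoped NNReal ENNReal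

noncomputable section

section ProductMeasures

variable {ι : Type*} [Fintype ι] {Ω : ι → Type*} [∀ i, MeasurableSpace (Ω i)]

lemma lintegral_pi_prod (μ : ∀ i, Measure (Ω i)) [∀ i, IsProbabilityMeasure (μ i)]
    {f : ∀ i, Ω i → ℝ≥0∞} (hf : ∀ i, Measurable (f i)) :
    ∫⁻ x, ∏ i, f i (x i) ∂Measure.pi μ = ∏ i, ∫⁻ x, f i x ∂μ i := by
  rw [lintegral_prod_eq_prod_lintegral_of_indepFun Finset.univ
    (fun i (x : ∀ i, Ω i) => f i (x i)) (iIndepFun_pi fun i => (hf i).aemeasurable)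
    (fun i => (hf i).comp (measurable_pi_apply i))]
  exact Finset.prod_congr rfl fun i _ =>
    (measurePreserving_eval μ i).lintegral_comp (hf i)

lemma pi_withDensity_prod (μ : ∀ i, Measure (Ω i)) [∀ i, IsProbabilityMeasure (μ i)]
    {f : ∀ i, Ω i → ℝ≥0∞} (hf : ∀ i, Measurable (f i))
    [∀ i, SigmaFinite ((μ i).withDensity (f i))] :
    Measure.pi (fun i => (μ i).withDensity (f i)) =
      (Measure.pi μ).withDensity (fun x => ∏ i, f i (x i)) := by
  refine Measure.pi_eq fun s hs => ?_
  rw [withDensity_apply _ (MeasurableSet.univ_pi hs),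
    ← lintegral_indicator (MeasurableSet.univ_pi hs)]
  have h : (Set.univ.pi s).indicator (fun x : ∀ i, Ω i => ∏ i, f i (x i)) =
      fun x => ∏ i, (s i).indicator (f i) (x i) := by
    classical
    ext x
    by_cases hx : ∀ i, x i ∈ s i
    · rw [Set.indicator_of_mem (by simpa using hx)]
      exact Finset.prod_congr rfl fun i _ => by rw [Set.indicator_of_mem (hx i)]
    · rw [Set.indicator_of_notMem (by simpa using hx)]
      push Not at hx
      obtain ⟨i, hi⟩ := hx
      exact (Finset.prod_eq_zero (Finset.mem_univ i) (Set.indicator_of_notMem hi _)).symm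
  rw [h, lintegral_pi_prod μ fun i => (hf i).indicator (hs i)]
  exact Finset.prod_congr rfl fun i _ => by
    rw [withDensity_apply _ (hs i), lintegral_indicator (hs i)]

end ProductMeasures

section Transpose

variable {α : Type*} [MeasurableSpace α] (ν : Measure α) [IsProbabilityMeasure ν]

lemma map_transpose_pi (n p : ℕ) :
    (Measure.pi fun _ : Fin n => Measure.pi fun _ : Fin p => ν).map
        (fun X j r => X r j) =
      Measure.pi fun _ : Fin p => Measure.pi fun _ : Fin n => ν := by
  have h : ∀ a b : ℕ, (Measure.pi fun _ : Fin a => Measure.pi fun _ : Fin b => ν) =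
      (Measure.pi fun _ : Fin a × Fin b => ν).map (MeasurableEquiv.curry (Fin a) (Fin b) α) := by
    intro a b
    simp_rw [← Measure.infinitePi_eq_pi]
    exact (Measure.infinitePi_map_curry (fun _ _ => ν)).symm
  have hs := (measurePreserving_piCongrLeft (fun _ : Fin p × Fin n => ν)
    (Equiv.prodComm (Fin n) (Fin p))).map_eq
  rw [h p n, ← hs, h n p, Measure.map_map (by fun_prop) (by fun_prop),
    Measure.map_map (by fun_prop) (by fun_prop)]
  rfl

lemma lintegral_prod_columns {n p m : ℕ} {e : Fin m → Fin p} (he : Function.Injective e)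
    {F : (Fin n → α) → ℝ≥0∞} (hF : Measurable F) :
    ∫⁻ X, ∏ i, F (fun r => X r (e i)) ∂(Measure.pi fun _ : Fin n => Measure.pi fun _ : Fin p => ν) =
      (∫⁻ x, F x ∂(Measure.pi fun _ : Fin n => ν)) ^ m := by
  have h := lintegral_map (μ := Measure.pi fun _ : Fin n => Measure.pi fun _ : Fin p => ν)
    (f := fun Y : Fin p → Fin n → α => ∏ i, F (Y (e i))) (g := fun X j r => X r j)
    (Finset.measurable_prod _ fun i _ => hF.comp (measurable_pi_apply _)) (by fun_prop)
  rw [← h, map_transpose_pi]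
  have hind := (iIndepFun_pi (μ := fun _ : Fin p => Measure.pi fun _ : Fin n => ν)
    (X := fun _ => F) fun _ => hF.aemeasurable).precomp he
  rw [lintegral_prod_eq_prod_lintegral_of_indepFun Finset.univ
    (fun i (Y : Fin p → Fin n → α) => F (Y (e i))) hind
    (fun i => hF.comp (measurable_pi_apply _))]
  simp_rw [(measurePreserving_eval (fun _ : Fin p => Measure.pi fun _ : Fin n => ν)
    _).lintegral_comp hF]
  simp

lemma lintegral_column {n p : ℕ} (j : Fin p) {F : (Fin n → α) → ℝ≥0∞} (hF : Measurable F) :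
    ∫⁻ X, F (fun r => X r j) ∂(Measure.pi fun _ : Fin n => Measure.pi fun _ : Fin p => ν) =
      ∫⁻ x, F x ∂(Measure.pi fun _ : Fin n => ν) := by
  simpa using lintegral_prod_columns ν (m := 1) (e := fun _ => j)
    (Function.injective_of_subsingleton _) hF

end Transpose

section Gaussian

lemma lintegral_exp_quadratic_gaussianReal {v : ℝ≥0} (hv : v ≠ 0) (α θ : ℝ)
    (h : 0 < 1 + α * v) :
    ∫⁻ x, ENNReal.ofReal (Real.exp (θ * x - α * x ^ 2 / 2)) ∂gaussianReal 0 v =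
      ENNReal.ofReal ((√(1 + α * v))⁻¹ * Real.exp (θ ^ 2 * v / (2 * (1 + α * v)))) := by
  have hv0 : (0 : ℝ) < v := by positivity
  set q : ℝ≥0 := ⟨v / (1 + α * v), by positivity⟩ with hq
  have hqv : (q : ℝ) = v / (1 + α * v) := rfl
  have hq0 : q ≠ 0 := by
    have : (0 : ℝ) < q := by rw [hqv]; positivity
    exact_mod_cast this.ne'
  rw [gaussianReal_of_var_ne_zero _ hv,
    lintegral_withDensity_eq_lintegral_mul _ (measurable_gaussianPDF _ _) (by fun_prop)]
  have key : ∀ x : ℝ, gaussianPDFReal 0 v x * Real.exp (θ * x - α * x ^ 2 / 2) =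
      ((√(1 + α * v))⁻¹ * Real.exp (θ ^ 2 * v / (2 * (1 + α * v)))) *
        gaussianPDFReal (θ * q) q x := by
    intro x
    simp only [gaussianPDFReal, hqv]
    rw [show 2 * Real.pi * (v / (1 + α * v)) = (2 * Real.pi * v) / (1 + α * v) by ring,
      Real.sqrt_div (by positivity)]
    have hs : √(1 + α * v) ≠ 0 := by positivity
    have hs2 : √(2 * Real.pi * v) ≠ 0 := by positivity
    rw [inv_div, mul_assoc, ← Real.exp_add]
    have hD : 1 + α * v ≠ 0 := h.ne'
    have hrw : ∀ a b c d : ℝ, a ≠ 0 → a⁻¹ * b * (a / c * d) = c⁻¹ * (b * d) := by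
      intro a b c d ha
      field_simp
    rw [hrw _ _ _ _ hs, ← Real.exp_add]
    congr 2
    generalize hDdef : 1 + α * v = D at hD
    obtain rfl : α = (D - 1) / v := by rw [← hDdef]; field_simp; ring
    field_simp
    ring
  calc _ = ∫⁻ x, ENNReal.ofReal ((√(1 + α * v))⁻¹ * Real.exp (θ ^ 2 * v / (2 * (1 + α * v)))) *
        gaussianPDF (θ * q) q x := by
        refine lintegral_congr fun x => ?_
        simp only [Pi.mul_apply, gaussianPDF]
        rw [← ENNReal.ofReal_mul (gaussianPDFReal_nonneg _ _ _), key,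
          ENNReal.ofReal_mul (by positivity)]
    _ = _ := by
        rw [lintegral_const_mul _ (measurable_gaussianPDF _ _),
          lintegral_gaussianPDF_eq_one _ hq0, mul_one]

/-- The likelihood ratio of `N(t • x, I)` with respect to `N(0, I)`. -/
def lik {n : ℕ} (t : ℝ) (x z : Fin n → ℝ) : ℝ :=
  Real.exp (∑ r, (t * x r * z r - (t * x r) ^ 2 / 2))

lemma lik_pos {n : ℕ} (t : ℝ) (x z : Fin n → ℝ) : 0 < lik t x z := Real.exp_pos _

lemma measurable_lik {n : ℕ} (t : ℝ) :
    Measurable fun q : (Fin n → ℝ) × (Fin n → ℝ) => lik t q.1 q.2 := by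
  unfold lik; fun_prop

lemma ofReal_exp_sum {ι : Type*} (s : Finset ι) (f : ι → ℝ) :
    ENNReal.ofReal (Real.exp (∑ r ∈ s, f r)) = ∏ r ∈ s, ENNReal.ofReal (Real.exp (f r)) := by
  rw [Real.exp_sum, ENNReal.ofReal_prod_of_nonneg fun _ _ => (Real.exp_pos _).le]

lemma gaussianReal_map_add_eq_withDensity (c : ℝ) :
    (gaussianReal 0 1).map (· + c) =
      (gaussianReal 0 1).withDensity fun x => ENNReal.ofReal (Real.exp (c * x - c ^ 2 / 2)) := by
  rw [gaussianReal_map_add_const, gaussianReal_of_var_ne_zero _ one_ne_zero,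
    gaussianReal_of_var_ne_zero _ one_ne_zero,
    ← withDensity_mul _ (measurable_gaussianPDF _ _) (by fun_prop)]
  congr 1
  ext x
  simp only [Pi.mul_apply, gaussianPDF]
  rw [← ENNReal.ofReal_mul (gaussianPDFReal_nonneg _ _ _)]
  simp only [gaussianPDFReal]
  rw [mul_assoc (_⁻¹), ← Real.exp_add]
  congr 3
  simp
  ring

/-- Cameron–Martin formula for the standard Gaussian measure on `ℝⁿ`. -/
lemma lintegral_gaussian_shift {n : ℕ} (t : ℝ) (x : Fin n → ℝ) {f : (Fin n → ℝ) → ℝ≥0∞}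
    (hf : Measurable f) :
    ∫⁻ z, f (fun r => z r + t * x r) ∂(Measure.pi fun _ : Fin n => gaussianReal 0 1) =
      ∫⁻ z, f z * ENNReal.ofReal (lik t x z) ∂(Measure.pi fun _ : Fin n => gaussianReal 0 1) := by
  have hsig : ∀ r : Fin n, IsProbabilityMeasure ((gaussianReal 0 1).withDensity
      fun y => ENNReal.ofReal (Real.exp (t * x r * y - (t * x r) ^ 2 / 2))) := fun r => by
    rw [← gaussianReal_map_add_eq_withDensity]
    exact Measure.isProbabilityMeasure_map (by fun_prop)
  have hm : (Measure.pi fun _ : Fin n => gaussianReal 0 1).map (fun z r => z r + t * x r) =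
      (Measure.pi fun _ : Fin n => gaussianReal 0 1).withDensity
        (fun z => ENNReal.ofReal (lik t x z)) := by
    have : ∀ r : Fin n, SigmaFinite ((gaussianReal 0 1).map (· + t * x r)) := fun r => by
      rw [gaussianReal_map_add_eq_withDensity]; infer_instance
    rw [Measure.pi_map_pi (f := fun (r : Fin n) (y : ℝ) => y + t * x r) (by fun_prop)]
    simp_rw [gaussianReal_map_add_eq_withDensity]
    rw [pi_withDensity_prod _ (by fun_prop)]
    simp_rw [lik, ofReal_exp_sum]
  rw [← lintegral_map hf (by fun_prop), hm, lintegral_withDensity_eq_lintegral_mul _ _ hf]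
  · simp_rw [Pi.mul_apply, mul_comm]
  · exact ((measurable_lik t).comp (by fun_prop : Measurable fun z => (x, z))).ennreal_ofReal

end Gaussian

section Tilting

variable {n : ℕ}

/-- Closed form of `E_x[lik t x z]` for `x ~ N(0, I/n)` and `t² = n a`. -/
def tiltMean (a : ℝ) (z : Fin n → ℝ) : ℝ :=
  ∏ r, ((√(1 + a))⁻¹ * Real.exp (a * z r ^ 2 / (2 * (1 + a))))

/-- Closed form of `E_x[(lik t x z)²]` for `x ~ N(0, I/n)` and `t² = n a`. -/
def tiltSq (a : ℝ) (z : Fin n → ℝ) : ℝ :=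
  ∏ r, ((√(1 + 2 * a))⁻¹ * Real.exp (2 * a * z r ^ 2 / (1 + 2 * a)))

lemma tiltMean_pos {a : ℝ} (ha : 0 ≤ a) (z : Fin n → ℝ) : 0 < tiltMean a z :=
  Finset.prod_pos fun _ _ => by positivity

lemma tiltSq_pos {a : ℝ} (ha : 0 ≤ a) (z : Fin n → ℝ) : 0 < tiltSq a z :=
  Finset.prod_pos fun _ _ => by positivity

lemma measurable_tiltMean (a : ℝ) : Measurable (tiltMean (n := n) a) := by
  unfold tiltMean; fun_prop

lemma measurable_tiltSq (a : ℝ) : Measurable (tiltSq (n := n) a) := by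
  unfold tiltSq; fun_prop

lemma lintegral_pi_prod_exp_quadratic {v : ℝ≥0} (hv : v ≠ 0) (α : ℝ) (θ : Fin n → ℝ)
    (h : 0 < 1 + α * v) :
    ∫⁻ x, ENNReal.ofReal (Real.exp (∑ r, (θ r * x r - α * x r ^ 2 / 2)))
        ∂(Measure.pi fun _ : Fin n => gaussianReal 0 v) =
      ENNReal.ofReal
        (∏ r, ((√(1 + α * v))⁻¹ * Real.exp (θ r ^ 2 * v / (2 * (1 + α * v))))) := by
  simp_rw [ofReal_exp_sum]
  rw [lintegral_pi_prod (fun _ : Fin n => gaussianReal 0 v)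
    (f := fun r x => ENNReal.ofReal (Real.exp (θ r * x - α * x ^ 2 / 2))) (by fun_prop),
    ENNReal.ofReal_prod_of_nonneg fun _ _ => by positivity]
  exact Finset.prod_congr rfl fun r _ => lintegral_exp_quadratic_gaussianReal hv α (θ r) h

lemma lintegral_lik (hn : 0 < n) {a t : ℝ} (ha : 0 ≤ a) (ht : t ^ 2 = n * a) (z : Fin n → ℝ) :
    ∫⁻ x, ENNReal.ofReal (lik t x z) ∂(Measure.pi fun _ : Fin n => gaussianReal 0 (n : ℝ≥0)⁻¹) =
      ENNReal.ofReal (tiltMean a z) := by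
  have hn' : (n : ℝ) ≠ 0 := by positivity
  have hv : t ^ 2 * ((n : ℝ≥0)⁻¹ : ℝ≥0) = a := by
    push_cast; rw [ht]; field_simp
  have h := lintegral_pi_prod_exp_quadratic (n := n) (v := (n : ℝ≥0)⁻¹) (by positivity) (t ^ 2)
    (fun r => t * z r) (by rw [hv]; positivity)
  simp_rw [mul_pow, mul_right_comm (t ^ 2) _ (_ : ℝ), hv] at h
  rw [tiltMean, ← h]
  simp_rw [lik]
  congr! 5
  ring

lemma lintegral_lik_sq (hn : 0 < n) {a t : ℝ} (ha : 0 ≤ a) (ht : t ^ 2 = n * a)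
    (z : Fin n → ℝ) :
    ∫⁻ x, ENNReal.ofReal (lik t x z ^ 2)
        ∂(Measure.pi fun _ : Fin n => gaussianReal 0 (n : ℝ≥0)⁻¹) =
      ENNReal.ofReal (tiltSq a z) := by
  have hn' : (n : ℝ) ≠ 0 := by positivity
  have hv : 2 * t ^ 2 * ((n : ℝ≥0)⁻¹ : ℝ≥0) = 2 * a := by
    push_cast; rw [mul_assoc, ht]; field_simp
  have hv' : t ^ 2 * ((n : ℝ≥0)⁻¹ : ℝ≥0) = a := by linarith
  have h := lintegral_pi_prod_exp_quadratic (n := n) (v := (n : ℝ≥0)⁻¹) (by positivity)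
    (2 * t ^ 2) (fun r => 2 * t * z r) (by rw [hv]; positivity)
  rw [hv] at h
  have e : ∀ r, (2 * t * z r) ^ 2 * ((n : ℝ≥0)⁻¹ : ℝ≥0) / (2 * (1 + 2 * a)) =
      2 * a * z r ^ 2 / (1 + 2 * a) := fun r => by
    rw [← hv']; field_simp
  simp_rw [e] at h
  rw [tiltSq, ← h]
  simp_rw [lik, ← Real.exp_nat_mul, Finset.mul_sum]
  congr! 5
  push_cast
  ring

lemma lintegral_pi_prod_const_exp {α C : ℝ} (hC : 0 ≤ C) (h : 0 < 1 + α) :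
    ∫⁻ z, ENNReal.ofReal (∏ r, (C * Real.exp (- (α * z r ^ 2 / 2))))
        ∂(Measure.pi fun _ : Fin n => gaussianReal 0 1) =
      ENNReal.ofReal ((C * (√(1 + α))⁻¹) ^ n) := by
  have h1 := lintegral_pi_prod_exp_quadratic (n := n) (v := 1) one_ne_zero α (fun _ => 0)
    (by simpa using h)
  simp only [zero_mul, zero_sub, NNReal.coe_one, mul_one, ne_eq, OfNat.ofNat_ne_zero,
    not_false_eq_true, zero_pow, zero_div, Real.exp_zero, Finset.prod_const, Finset.card_univ,
    Fintype.card_fin] at h1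
  rw [mul_pow, ENNReal.ofReal_mul (by positivity), ← h1, ← lintegral_const_mul _ (by fun_prop)]
  refine lintegral_congr fun z => ?_
  rw [← ENNReal.ofReal_mul (by positivity), Finset.prod_mul_distrib, Real.exp_sum]
  simp

lemma lintegral_tiltSq_div_tiltMean {a : ℝ} (ha : 0 ≤ a) :
    ∫⁻ z, ENNReal.ofReal (tiltSq a z / tiltMean a z)
        ∂(Measure.pi fun _ : Fin n => gaussianReal 0 1) = ENNReal.ofReal ((1 + a) ^ n) := by
  have hα : 1 + -(4 * a / (1 + 2 * a) - a / (1 + a)) = ((1 + 2 * a) * (1 + a))⁻¹ := by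
    field_simp; ring
  have h := lintegral_pi_prod_const_exp (n := n) (α := -(4 * a / (1 + 2 * a) - a / (1 + a)))
    (C := (√(1 + 2 * a))⁻¹ * √(1 + a)) (by positivity) (by rw [hα]; positivity)
  rw [hα, Real.sqrt_inv, inv_inv, Real.sqrt_mul (by positivity)] at h
  have hs1 : √(1 + 2 * a) ≠ 0 := by positivity
  have hs2 : √(1 + a) ≠ 0 := by positivity
  have hC : (√(1 + 2 * a))⁻¹ * √(1 + a) * (√(1 + 2 * a) * √(1 + a)) = 1 + a := by
    field_simp; exact Real.sq_sqrt (by positivity)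
  rw [hC] at h
  rw [← h]
  refine lintegral_congr fun z => ?_
  rw [tiltSq, tiltMean, ← Finset.prod_div_distrib]
  congr 1
  refine Finset.prod_congr rfl fun r _ => ?_
  rw [mul_div_mul_comm, ← Real.exp_sub, div_inv_eq_mul]
  congr 2
  field_simp
  ring

lemma lintegral_tiltSq_sq_div_tiltMean_cube_le {a : ℝ} (ha : 0 ≤ a) (ha' : a ≤ 1 / 4) :
    ∫⁻ z, ENNReal.ofReal (tiltSq a z ^ 2 / tiltMean a z ^ 3)
        ∂(Measure.pi fun _ : Fin n => gaussianReal 0 1) ≤ ENNReal.ofReal (Real.exp (4 * (n * a))) := by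
  have h2 : 0 < 1 - 2 * a := by linarith
  have hα : 1 + -(8 * a / (1 + 2 * a) - 3 * a / (1 + a)) =
      (1 - 2 * a) / ((1 + 2 * a) * (1 + a)) := by
    field_simp; ring
  have h := lintegral_pi_prod_const_exp (n := n) (α := -(8 * a / (1 + 2 * a) - 3 * a / (1 + a)))
    (C := (√(1 + 2 * a))⁻¹ ^ 2 * √(1 + a) ^ 3) (by positivity) (by rw [hα]; positivity)
  have e : ∀ z : Fin n → ℝ, tiltSq a z ^ 2 / tiltMean a z ^ 3 =
      ∏ r, ((√(1 + 2 * a))⁻¹ ^ 2 * √(1 + a) ^ 3 *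
        Real.exp (-(-(8 * a / (1 + 2 * a) - 3 * a / (1 + a)) * z r ^ 2 / 2))) := by
    intro z
    rw [tiltSq, tiltMean, ← Finset.prod_pow, ← Finset.prod_pow, ← Finset.prod_div_distrib]
    refine Finset.prod_congr rfl fun r _ => ?_
    rw [mul_pow, mul_pow, mul_div_mul_comm, ← Real.exp_nat_mul, ← Real.exp_nat_mul,
      ← Real.exp_sub, inv_pow (√(1 + a)), div_inv_eq_mul]
    congr 2
    push_cast
    field_simp
    ring
  simp_rw [e]
  rw [h, hα]
  refine ENNReal.ofReal_le_ofReal ?_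
  rw [show 4 * (n * a) = n * (4 * a) by ring, Real.exp_nat_mul]
  refine pow_le_pow_left₀ (by positivity) ?_ n
  have hsq : Real.exp (4 * a) = √(Real.exp (8 * a)) := by
    rw [← Real.sqrt_sq (Real.exp_pos (4 * a)).le, ← Real.exp_nat_mul]
    congr 2; push_cast; ring
  have hval : (√(1 + 2 * a))⁻¹ ^ 2 * √(1 + a) ^ 3 *
      (√((1 - 2 * a) / ((1 + 2 * a) * (1 + a))))⁻¹ =
      √((1 + a) ^ 4 / ((1 + 2 * a) * (1 - 2 * a))) := by
    rw [← Real.sqrt_sq (show (0:ℝ) ≤ (√(1 + 2 * a))⁻¹ ^ 2 * √(1 + a) ^ 3 *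
      (√((1 - 2 * a) / ((1 + 2 * a) * (1 + a))))⁻¹ by positivity)]
    congr 1
    rw [mul_pow, mul_pow, inv_pow, inv_pow, inv_pow, Real.sq_sqrt (by positivity),
      Real.sq_sqrt (by positivity), ← pow_mul, mul_comm 3 2, pow_mul, Real.sq_sqrt (by positivity)]
    field_simp
  rw [hval, hsq]
  refine Real.sqrt_le_sqrt ?_
  rw [div_le_iff₀ (by positivity)]
  have h4 : (1 + a) ^ 4 ≤ Real.exp (4 * a) := by
    rw [show 4 * a = (4 : ℕ) * a by norm_num, Real.exp_nat_mul]
    gcongr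
    linarith [Real.add_one_le_exp a]
  have h5 : 1 ≤ Real.exp (4 * a) * ((1 + 2 * a) * (1 - 2 * a)) := by
    have h6 : 4 * a + 1 ≤ Real.exp (4 * a) := Real.add_one_le_exp _
    calc (1 : ℝ) ≤ (4 * a + 1) * ((1 + 2 * a) * (1 - 2 * a)) := by nlinarith [mul_nonneg ha ha]
      _ ≤ _ := by gcongr
  calc (1 + a) ^ 4 ≤ Real.exp (4 * a) * 1 := by linarith
    _ ≤ Real.exp (4 * a) * (Real.exp (4 * a) * ((1 + 2 * a) * (1 - 2 * a))) := by gcongr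
    _ = Real.exp (8 * a) * ((1 + 2 * a) * (1 - 2 * a)) := by
      rw [← mul_assoc, ← Real.exp_add]; ring_nf

end Tilting

section LowerTail

lemma exp_neg_add_le {u : ℝ} (hu : 0 ≤ u) : Real.exp (-u) + u ≤ 1 + u ^ 2 / 2 := by
  have h := Real.quadratic_le_exp_of_nonneg hu
  have h1 : Real.exp (-u) * Real.exp u = 1 := by rw [← Real.exp_add]; simp
  have h2 := Real.exp_pos (-u)
  have h3 : 0 ≤ 1 - u + u ^ 2 / 2 := by nlinarith [sq_nonneg (u - 1)]
  have h4 : Real.exp (-u) * (1 + u + u ^ 2 / 2) ≤ 1 :=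
    (mul_le_mul_of_nonneg_left h h2.le).trans_eq h1
  nlinarith [mul_le_mul_of_nonneg_right h4 h3, mul_nonneg h2.le (sq_nonneg (u ^ 2))]

/-- One-sided Bernstein-type bound on the Laplace transform of a nonnegative variable. -/
lemma lintegral_exp_neg_mul_le {Ω : Type*} [MeasurableSpace Ω] {P : Measure Ω}
    [IsProbabilityMeasure P] {F : Ω → ℝ} (hF : Measurable F) (hF0 : ∀ ω, 0 ≤ F ω) {d s l : ℝ}
    (hd : ∫⁻ ω, ENNReal.ofReal (F ω) ∂P = ENNReal.ofReal d)
    (hs : ∫⁻ ω, ENNReal.ofReal (F ω ^ 2) ∂P ≤ ENNReal.ofReal s)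
    (hd0 : 0 ≤ d) (hs0 : 0 ≤ s) (hl : 0 ≤ l) :
    ∫⁻ ω, ENNReal.ofReal (Real.exp (-(l * F ω))) ∂P ≤
      ENNReal.ofReal (Real.exp (-(l * d) + l ^ 2 * s / 2)) := by
  have hpt : ∀ ω, ENNReal.ofReal (Real.exp (-(l * F ω))) + ENNReal.ofReal l * ENNReal.ofReal (F ω) ≤
      1 + ENNReal.ofReal (l ^ 2 / 2) * ENNReal.ofReal (F ω ^ 2) := by
    intro ω
    have hu : 0 ≤ l * F ω := mul_nonneg hl (hF0 ω)
    rw [← ENNReal.ofReal_mul hl, ← ENNReal.ofReal_mul (by positivity),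
      ← ENNReal.ofReal_add (by positivity) hu, ← ENNReal.ofReal_one,
      ← ENNReal.ofReal_add (by positivity) (by positivity)]
    exact ENNReal.ofReal_le_ofReal ((exp_neg_add_le hu).trans_eq (by ring))
  have h_int := lintegral_mono (μ := P) hpt
  rw [lintegral_add_left (by fun_prop), lintegral_add_left (by fun_prop),
    lintegral_const_mul _ (by fun_prop), lintegral_const_mul _ (by fun_prop), hd,
    lintegral_const, measure_univ, mul_one, ← ENNReal.ofReal_mul hl] at h_int
  have h1 : ∫⁻ ω, ENNReal.ofReal (Real.exp (-(l * F ω))) ∂P + ENNReal.ofReal (l * d) ≤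
      ENNReal.ofReal (1 + l ^ 2 / 2 * s) := by
    refine h_int.trans ?_
    rw [ENNReal.ofReal_add (by positivity) (by positivity), ENNReal.ofReal_one,
      ENNReal.ofReal_mul (by positivity)]
    gcongr
  refine (ENNReal.le_sub_of_add_le_right ENNReal.ofReal_ne_top h1).trans ?_
  rw [← ENNReal.ofReal_sub _ (by positivity)]
  refine ENNReal.ofReal_le_ofReal ?_
  linarith [Real.add_one_le_exp (-(l * d) + l ^ 2 * s / 2)]

lemma mul_exp_laplace_le {d s ε : ℝ} {m : ℕ} (hd : 0 < d) (hs : 0 < s) (hε : 0 < ε) (hm : 0 < m) :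
    d * Real.exp (ε * d / s * ((1 - ε) * m * d)) *
        Real.exp (-(ε * d / s * d) + (ε * d / s) ^ 2 * s / 2) ^ m ≤
      8 / (m ^ 2 * ε ^ 4) * (s ^ 2 / d ^ 3) := by
  have hm' : (0 : ℝ) < m := by exact_mod_cast hm
  set x := m * ε ^ 2 * d ^ 2 / (2 * s) with hx
  have hx0 : 0 < x := by positivity
  rw [← Real.exp_nat_mul, mul_assoc, ← Real.exp_add]
  have e : ε * d / s * ((1 - ε) * m * d) + m * (-(ε * d / s * d) + (ε * d / s) ^ 2 * s / 2) =
      -x := by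
    rw [hx]; field_simp; ring
  rw [e]
  have h1 : Real.exp (-x) ≤ 2 / x ^ 2 := by
    rw [le_div_iff₀ (by positivity), Real.exp_neg, inv_mul_le_iff₀ (Real.exp_pos _)]
    nlinarith [Real.quadratic_le_exp_of_nonneg hx0.le]
  calc d * Real.exp (-x) ≤ d * (2 / x ^ 2) := by gcongr
    _ = _ := by rw [hx]; field_simp; ring

lemma lintegral_lower_tail_le {α : Type*} [MeasurableSpace α] (ν : Measure α)
    [IsProbabilityMeasure ν] {n p m : ℕ} (hm : 0 < m) {e : Fin m → Fin p}
    (he : Function.Injective e) {g : (Fin n → α) → ℝ} (hg : Measurable g) (hg0 : ∀ x, 0 ≤ g x)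
    {d s ε : ℝ} (hd0 : 0 < d) (hs0 : 0 < s) (hε : 0 < ε)
    (hd : ∫⁻ x, ENNReal.ofReal (g x) ∂(Measure.pi fun _ => ν) = ENNReal.ofReal d)
    (hs : ∫⁻ x, ENNReal.ofReal (g x ^ 2) ∂(Measure.pi fun _ => ν) ≤ ENNReal.ofReal s) :
    ∫⁻ X, ENNReal.ofReal
        (d * Real.exp (ε * d / s * ((1 - ε) * m * d - ∑ i, g (fun r => X r (e i)))))
        ∂(Measure.pi fun _ : Fin n => Measure.pi fun _ : Fin p => ν) ≤
      ENNReal.ofReal (8 / (m ^ 2 * ε ^ 4) * (s ^ 2 / d ^ 3)) := by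
  have hl : 0 ≤ ε * d / s := by positivity
  calc _ = ∫⁻ X, ENNReal.ofReal (d * Real.exp (ε * d / s * ((1 - ε) * m * d))) *
        ∏ i, ENNReal.ofReal (Real.exp (-(ε * d / s * g (fun r => X r (e i)))))
        ∂(Measure.pi fun _ : Fin n => Measure.pi fun _ : Fin p => ν) := by
        refine lintegral_congr fun X => ?_
        rw [← ofReal_exp_sum, ← ENNReal.ofReal_mul (by positivity), mul_assoc d, ← Real.exp_add,
          Finset.sum_neg_distrib, ← Finset.mul_sum]
        congr 3
        ring
    _ = ENNReal.ofReal (d * Real.exp (ε * d / s * ((1 - ε) * m * d))) *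
        (∫⁻ x, ENNReal.ofReal (Real.exp (-(ε * d / s * g x))) ∂(Measure.pi fun _ => ν)) ^ m := by
        rw [lintegral_const_mul _ (by fun_prop),
          lintegral_prod_columns ν he
            (F := fun x => ENNReal.ofReal (Real.exp (-(ε * d / s * g x)))) (by fun_prop)]
    _ ≤ ENNReal.ofReal (d * Real.exp (ε * d / s * ((1 - ε) * m * d))) *
        (ENNReal.ofReal (Real.exp (-(ε * d / s * d) + (ε * d / s) ^ 2 * s / 2))) ^ m := by
        gcongr
        exact lintegral_exp_neg_mul_le hg hg0 hd hs hd0.le hs0.le hl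
    _ ≤ _ := by
        rw [← ENNReal.ofReal_pow (by positivity), ← ENNReal.ofReal_mul (by positivity)]
        exact ENNReal.ofReal_le_ofReal (mul_exp_laplace_le hd0 hs0 hε hm)

end LowerTail

section Posterior

/-- The sign `±1` encoded by a Boolean. -/
def boolSign (b : Bool) : ℝ := cond b 1 (-1)

lemma boolSign_sq (b : Bool) : boolSign b ^ 2 = 1 := by cases b <;> simp [boolSign]

/-- Weighted least squares: the pointwise posterior risk of a random signed spike of height `τ`. -/
lemma mul_sum_le_sum_sq_add {m : ℕ} (W : Fin m → Bool → ℝ)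
    (hS : 0 < ∑ i, ∑ b, W i b) (h : Fin m → ℝ) (τ : ℝ) :
    τ ^ 2 * ∑ i, ∑ b, W i b ≤
      ∑ i, ∑ b, (∑ i', (h i' - if i' = i then boolSign b * τ else 0) ^ 2) * W i b +
        τ ^ 2 * ((∑ i, (W i true - W i false) ^ 2) / ∑ i, ∑ b, W i b) := by
  have hin : ∀ i b, ∑ i', (h i' - if i' = i then boolSign b * τ else 0) ^ 2 =
      ∑ i', h i' ^ 2 + (τ ^ 2 - 2 * boolSign b * τ * h i) := by
    intro i b
    have : ∀ i', (h i' - if i' = i then boolSign b * τ else 0) ^ 2 =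
        h i' ^ 2 + if i' = i then τ ^ 2 - 2 * boolSign b * τ * h i' else 0 := by
      intro i'
      split_ifs
      · linear_combination τ ^ 2 * boolSign_sq b
      · ring
    simp_rw [this, Finset.sum_add_distrib]
    simp
  simp_rw [hin]
  set H := ∑ i', h i' ^ 2 with hH
  set S := ∑ i, ∑ b, W i b with hSdef
  have htot : ∑ i, ∑ b, (H + (τ ^ 2 - 2 * boolSign b * τ * h i)) * W i b =
      (H + τ ^ 2) * S - 2 * τ * ∑ i, h i * (W i true - W i false) := by
    simp only [hSdef, Finset.mul_sum, ← Finset.sum_sub_distrib, Fintype.sum_bool, boolSign, cond_true,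
      cond_false]
    exact Finset.sum_congr rfl fun i _ => by ring
  have hsq : 0 ≤ ∑ i, (S * h i - τ * (W i true - W i false)) ^ 2 / S :=
    Finset.sum_nonneg fun i _ => by positivity
  have hexp : ∑ i, (S * h i - τ * (W i true - W i false)) ^ 2 / S =
      H * S - 2 * τ * ∑ i, h i * (W i true - W i false) +
        τ ^ 2 * ((∑ i, (W i true - W i false) ^ 2) / S) := by
    rw [hH, Finset.sum_mul, Finset.mul_sum, Finset.sum_div, Finset.mul_sum,
      ← Finset.sum_sub_distrib, ← Finset.sum_add_distrib]
    refine Finset.sum_congr rfl fun i _ => ?_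
    field_simp
    ring
  rw [htot]
  linarith

lemma sum_sq_div_sum_le {m : ℕ} (W : Fin m → Bool → ℝ) (hW : ∀ i b, 0 ≤ W i b)
    (hS : 0 < ∑ i, ∑ b, W i b) {d ε l : ℝ} (hd : 0 < d) (hm : 0 < m) (hε : 0 < ε)
    (hε1 : ε < 1) (hl : 0 ≤ l) :
    (∑ i, (W i true - W i false) ^ 2) / ∑ i, ∑ b, W i b ≤
      (∑ i, (W i true - W i false) ^ 2) / (2 * m * (1 - ε) * d) +
        2 * m * (d * Real.exp (l * ((1 - ε) * m * d - ∑ i, (∑ b, W i b) / 2))) := by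
  have hm' : (0 : ℝ) < m := by exact_mod_cast hm
  have hε' : 0 < 1 - ε := by linarith
  rw [← Finset.sum_div]
  set S := ∑ i, ∑ b, W i b with hSdef
  set N := ∑ i, (W i true - W i false) ^ 2 with hN
  have hN0 : 0 ≤ N := Finset.sum_nonneg fun _ _ => sq_nonneg _
  have hNS : N ≤ S ^ 2 := by
    calc N ≤ ∑ i, (∑ b, W i b) ^ 2 := by
          refine Finset.sum_le_sum fun i _ => ?_
          simp only [Fintype.sum_bool]
          nlinarith [mul_nonneg (hW i true) (hW i false)]
      _ ≤ S ^ 2 := Finset.sum_sq_le_sq_sum_of_nonneg fun i _ =>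
          Finset.sum_nonneg fun b _ => hW i b
  rcases le_or_gt (2 * m * (1 - ε) * d) S with h | h
  · calc N / S ≤ N / (2 * m * (1 - ε) * d) := by gcongr
      _ ≤ _ := le_add_of_nonneg_right (by positivity)
  · calc N / S ≤ S := by rw [div_le_iff₀ hS]; linarith [sq S]
      _ ≤ 2 * m * (d * 1) := by nlinarith [mul_pos (mul_pos hm' hε) hd]
      _ ≤ 2 * m * (d * Real.exp (l * ((1 - ε) * m * d - S / 2))) := by
        gcongr
        exact Real.one_le_exp (mul_nonneg hl (by linarith))
      _ ≤ _ := le_add_of_nonneg_left (by positivity)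

end Posterior

section Block

instance (n p : ℕ) : IsProbabilityMeasure (model n p) := by unfold model; infer_instance

lemma measurable_lik_column {n p : ℕ} (t : ℝ) (j : Fin p) :
    Measurable fun ω : (Fin n → Fin p → ℝ) × (Fin n → ℝ) => lik t (fun r => ω.1 r j) ω.2 :=
  (measurable_lik t).comp (by fun_prop : Measurable fun ω : (Fin n → Fin p → ℝ) × (Fin n → ℝ) =>
    ((fun r => ω.1 r j : Fin n → ℝ), ω.2))

lemma lintegral_model_shift {n p : ℕ} (t : ℝ) (j : Fin p)
    {H : (Fin n → Fin p → ℝ) × (Fin n → ℝ) → ℝ≥0∞} (hH : Measurable H) :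
    ∫⁻ ω, H (ω.1, fun r => ω.2 r + t * ω.1 r j) ∂model n p =
      ∫⁻ ω, H ω * ENNReal.ofReal (lik t (fun r => ω.1 r j) ω.2) ∂model n p := by
  have hL := measurable_lik_column (n := n) t j
  rw [model, lintegral_prod _ (by fun_prop), lintegral_prod _ (by fun_prop)]
  exact lintegral_congr fun X =>
    lintegral_gaussian_shift t (fun r => X r j) (f := fun z => H (X, z)) (by fun_prop)

lemma lintegral_model_lik {n p : ℕ} (t : ℝ) (j : Fin p) :
    ∫⁻ ω, ENNReal.ofReal (lik t (fun r => ω.1 r j) ω.2) ∂model n p = 1 := by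
  have h := lintegral_model_shift (n := n) t j (H := fun _ => 1) measurable_const
  simpa using h.symm

lemma lintegral_column_sq_div_le {n p : ℕ} (hn : 0 < n) {a μ : ℝ} (ha : 0 ≤ a)
    (hμ : μ ^ 2 = n * a) (j : Fin p) (z : Fin n → ℝ) {c : ℝ} (hc : 0 ≤ c) :
    ∫⁻ X, ENNReal.ofReal (c * (lik μ (fun r => X r j) z - lik (-μ) (fun r => X r j) z) ^ 2)
        ∂(Measure.pi fun _ : Fin n => Measure.pi fun _ : Fin p => gaussianReal 0 (n : ℝ≥0)⁻¹) ≤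
      ENNReal.ofReal (c * (2 * tiltSq a z)) := by
  have hμ' : (-μ) ^ 2 = n * a := by rw [neg_sq, hμ]
  have hm : ∀ t, Measurable fun x : Fin n → ℝ => lik t x z := fun t =>
    (measurable_lik t).comp (by fun_prop : Measurable fun x : Fin n → ℝ => (x, z))
  have hm1 := hm μ
  have hm2 := hm (-μ)
  rw [lintegral_column (gaussianReal 0 (n : ℝ≥0)⁻¹) j
    (F := fun x => ENNReal.ofReal (c * (lik μ x z - lik (-μ) x z) ^ 2)) (by fun_prop)]
  calc _ ≤ ∫⁻ x, ENNReal.ofReal c * (ENNReal.ofReal (lik μ x z ^ 2) +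
        ENNReal.ofReal (lik (-μ) x z ^ 2))
        ∂(Measure.pi fun _ : Fin n => gaussianReal 0 (n : ℝ≥0)⁻¹) := by
        refine lintegral_mono fun x => ?_
        rw [← ENNReal.ofReal_add (by positivity) (by positivity), ← ENNReal.ofReal_mul hc]
        refine ENNReal.ofReal_le_ofReal ?_
        gcongr
        nlinarith [mul_pos (lik_pos μ x z) (lik_pos (-μ) x z)]
    _ = _ := by
        rw [lintegral_const_mul _ (by fun_prop), lintegral_add_left (by fun_prop),
          lintegral_lik_sq hn ha hμ, lintegral_lik_sq hn ha hμ',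
          ← ENNReal.ofReal_add (tiltSq_pos ha z).le (tiltSq_pos ha z).le, ← ENNReal.ofReal_mul hc,
          two_mul]

lemma lintegral_average_lik {n : ℕ} (hn : 0 < n) {a μ : ℝ} (ha : 0 ≤ a) (hμ : μ ^ 2 = n * a)
    (z : Fin n → ℝ) :
    ∫⁻ x, ENNReal.ofReal ((∑ b, lik (boolSign b * μ) x z) / 2)
        ∂(Measure.pi fun _ : Fin n => gaussianReal 0 (n : ℝ≥0)⁻¹) =
      ENNReal.ofReal (tiltMean a z) := by
  have hμb : ∀ b, (boolSign b * μ) ^ 2 = n * a := fun b => by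
    rw [mul_pow, boolSign_sq, one_mul, hμ]
  have hm : ∀ t, Measurable fun x : Fin n → ℝ => lik t x z := fun t =>
    (measurable_lik t).comp (by fun_prop : Measurable fun x : Fin n → ℝ => (x, z))
  have hp : ∀ x : Fin n → ℝ, ENNReal.ofReal ((∑ b, lik (boolSign b * μ) x z) / 2) =
      ENNReal.ofReal (1 / 2) * ∑ b, ENNReal.ofReal (lik (boolSign b * μ) x z) := fun x => by
    rw [← ENNReal.ofReal_sum_of_nonneg fun _ _ => (lik_pos _ _ _).le,
      ← ENNReal.ofReal_mul (by positivity)]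
    congr 1; ring
  simp_rw [hp]
  have hm' : ∀ b, Measurable fun x : Fin n → ℝ => ENNReal.ofReal (lik (boolSign b * μ) x z) :=
    fun b => (hm _).ennreal_ofReal
  rw [lintegral_const_mul _ (by fun_prop), lintegral_finsetSum _ (fun b _ => hm' b)]
  simp_rw [lintegral_lik hn ha (hμb _)]
  rw [← ENNReal.ofReal_sum_of_nonneg fun _ _ => (tiltMean_pos ha z).le,
    ← ENNReal.ofReal_mul (by positivity)]
  congr 1
  simp

lemma lintegral_average_lik_sq_le {n : ℕ} (hn : 0 < n) {a μ : ℝ} (ha : 0 ≤ a)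
    (hμ : μ ^ 2 = n * a) (z : Fin n → ℝ) :
    ∫⁻ x, ENNReal.ofReal (((∑ b, lik (boolSign b * μ) x z) / 2) ^ 2)
        ∂(Measure.pi fun _ : Fin n => gaussianReal 0 (n : ℝ≥0)⁻¹) ≤
      ENNReal.ofReal (tiltSq a z) := by
  have hμb : ∀ b, (boolSign b * μ) ^ 2 = n * a := fun b => by
    rw [mul_pow, boolSign_sq, one_mul, hμ]
  have hm : ∀ t, Measurable fun x : Fin n → ℝ => lik t x z := fun t =>
    (measurable_lik t).comp (by fun_prop : Measurable fun x : Fin n → ℝ => (x, z))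
  have hm' : ∀ b, Measurable fun x : Fin n → ℝ => ENNReal.ofReal (lik (boolSign b * μ) x z ^ 2) :=
    fun b => ((hm _).pow_const 2).ennreal_ofReal
  have hp : ∀ x : Fin n → ℝ, ENNReal.ofReal (((∑ b, lik (boolSign b * μ) x z) / 2) ^ 2) ≤
      ENNReal.ofReal (1 / 2) * ∑ b, ENNReal.ofReal (lik (boolSign b * μ) x z ^ 2) := fun x => by
    rw [← ENNReal.ofReal_sum_of_nonneg fun _ _ => by positivity,
      ← ENNReal.ofReal_mul (by positivity)]
    refine ENNReal.ofReal_le_ofReal ?_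
    simp only [Fintype.sum_bool]
    nlinarith [sq_nonneg (lik (boolSign true * μ) x z - lik (boolSign false * μ) x z)]
  refine (lintegral_mono hp).trans ?_
  rw [lintegral_const_mul _ (by fun_prop), lintegral_finsetSum _ (fun b _ => hm' b)]
  simp_rw [lintegral_lik_sq hn ha (hμb _)]
  rw [← ENNReal.ofReal_sum_of_nonneg fun _ _ => (tiltSq_pos ha z).le,
    ← ENNReal.ofReal_mul (by positivity)]
  exact ENNReal.ofReal_le_ofReal (by simp)

end Block

section BlockRisk

/-- Upper bound on the fraction of the squared signal that can be recovered within one block. -/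
def gainBound (n m : ℕ) (a ε : ℝ) : ℝ :=
  (1 + a) ^ n / (2 * m * (1 - ε)) + 8 / (m ^ 2 * ε ^ 4) * Real.exp (4 * (n * a))

variable {n p m : ℕ} {e : Fin m → Fin p} {a μ τ ε : ℝ}

lemma lintegral_posterior_gain_main_le (hn : 0 < n) (hm : 0 < m) (ha : 0 ≤ a)
    (hμ : μ ^ 2 = n * a) (hε1 : ε < 1) :
    ∫⁻ ω, ENNReal.ofReal ((∑ i, (lik (boolSign true * μ) (fun r => ω.1 r (e i)) ω.2 -
        lik (boolSign false * μ) (fun r => ω.1 r (e i)) ω.2) ^ 2) /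
          (2 * m * (1 - ε) * tiltMean a ω.2)) ∂model n p ≤
      ENNReal.ofReal (2 * m * ((1 + a) ^ n / (2 * m * (1 - ε)))) := by
  have hm' : (0 : ℝ) < m := by exact_mod_cast hm
  have hε' : 0 < 1 - ε := by linarith
  have hL := fun t j => measurable_lik_column (n := n) (p := p) t j
  have hd := measurable_tiltMean (n := n) a
  have hs := measurable_tiltSq (n := n) a
  simp only [boolSign, cond_true, cond_false, one_mul, neg_one_mul]
  have hmeas : Measurable fun ω : (Fin n → Fin p → ℝ) × (Fin n → ℝ) =>
      ENNReal.ofReal ((∑ i, (lik μ (fun r => ω.1 r (e i)) ω.2 -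
        lik (-μ) (fun r => ω.1 r (e i)) ω.2) ^ 2) / (2 * m * (1 - ε) * tiltMean a ω.2)) := by
    refine Measurable.ennreal_ofReal (Measurable.div (Finset.measurable_sum _ fun i _ => ?_) ?_)
    · exact ((hL _ _).sub (hL _ _)).pow_const 2
    · fun_prop
  rw [model, lintegral_prod_symm _ hmeas.aemeasurable]
  calc _ ≤ ∫⁻ z, ENNReal.ofReal (1 - ε)⁻¹ * ENNReal.ofReal (tiltSq a z / tiltMean a z)
        ∂(Measure.pi fun _ : Fin n => gaussianReal 0 1) := by
        refine lintegral_mono fun z => ?_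
        have hdz := tiltMean_pos ha z
        have hsz := tiltSq_pos ha z
        set c := (2 * m * (1 - ε) * tiltMean a z)⁻¹ with hc
        have hc0 : 0 ≤ c := by positivity
        have hsec : ∀ t j, Measurable fun X : Fin n → Fin p → ℝ => lik t (fun r => X r j) z :=
          fun t j => (hL t j).comp (by fun_prop : Measurable fun X : Fin n → Fin p → ℝ => (X, z))
        have hmi : ∀ i, Measurable fun X : Fin n → Fin p → ℝ => ENNReal.ofReal
            (c * (lik μ (fun r => X r (e i)) z - lik (-μ) (fun r => X r (e i)) z) ^ 2) := fun i =>
          (((hsec _ _).sub (hsec _ _)).pow_const 2 |>.const_mul c).ennreal_ofReal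
        calc _ = ∫⁻ X, ∑ i, ENNReal.ofReal (c * (lik μ (fun r => X r (e i)) z -
              lik (-μ) (fun r => X r (e i)) z) ^ 2) ∂(Measure.pi fun _ : Fin n =>
                Measure.pi fun _ : Fin p => gaussianReal 0 (n : ℝ≥0)⁻¹) := by
              refine lintegral_congr fun X => ?_
              rw [← ENNReal.ofReal_sum_of_nonneg fun _ _ => by positivity, ← Finset.mul_sum, hc,
                div_eq_mul_inv]
              congr 1
              exact mul_comm _ _
          _ ≤ ∑ _i : Fin m, ENNReal.ofReal (c * (2 * tiltSq a z)) := by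
              rw [lintegral_finsetSum _ fun i _ => hmi i]
              exact Finset.sum_le_sum fun i _ => lintegral_column_sq_div_le hn ha hμ (e i) z hc0
          _ = _ := by
              rw [← ENNReal.ofReal_sum_of_nonneg fun _ _ => by positivity,
                ← ENNReal.ofReal_mul (by positivity)]
              congr 1
              simp only [Finset.sum_const, Finset.card_univ, Fintype.card_fin, nsmul_eq_mul, hc]
              field_simp
    _ = _ := by
        rw [lintegral_const_mul _ (by fun_prop), lintegral_tiltSq_div_tiltMean ha,
          ← ENNReal.ofReal_mul (by positivity)]
        congr 1
        field_simp

lemma lintegral_posterior_gain_tail_le (hn : 0 < n) (hm : 0 < m) (he : Function.Injective e)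
    (ha : 0 ≤ a) (ha' : a ≤ 1 / 4) (hμ : μ ^ 2 = n * a) (hε : 0 < ε) :
    ∫⁻ ω, ENNReal.ofReal (2 * m * (tiltMean a ω.2 *
        Real.exp (ε * tiltMean a ω.2 / tiltSq a ω.2 * ((1 - ε) * m * tiltMean a ω.2 -
          ∑ i, (∑ b, lik (boolSign b * μ) (fun r => ω.1 r (e i)) ω.2) / 2)))) ∂model n p ≤
      ENNReal.ofReal (2 * m * (8 / (m ^ 2 * ε ^ 4) * Real.exp (4 * (n * a)))) := by
  have hm' : (0 : ℝ) < m := by exact_mod_cast hm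
  have hL := fun t j => measurable_lik_column (n := n) (p := p) t j
  have hd := measurable_tiltMean (n := n) a
  have hs := measurable_tiltSq (n := n) a
  have hsum : Measurable fun ω : (Fin n → Fin p → ℝ) × (Fin n → ℝ) =>
      ∑ i, (∑ b, lik (boolSign b * μ) (fun r => ω.1 r (e i)) ω.2) / 2 :=
    Finset.measurable_sum _ fun i _ => (Finset.measurable_sum _ fun b _ => hL _ _).div_const 2
  have hg : ∀ z, Measurable fun x : Fin n → ℝ => (∑ b, lik (boolSign b * μ) x z) / 2 := fun z =>
    (Finset.measurable_sum _ fun b _ => (measurable_lik _).comp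
      (by fun_prop : Measurable fun x : Fin n → ℝ => (x, z))).div_const 2
  rw [model, lintegral_prod_symm _ (by fun_prop)]
  calc _ ≤ ∫⁻ z, ENNReal.ofReal (2 * m * (8 / (m ^ 2 * ε ^ 4))) *
        ENNReal.ofReal (tiltSq a z ^ 2 / tiltMean a z ^ 3)
        ∂(Measure.pi fun _ : Fin n => gaussianReal 0 1) := by
        refine lintegral_mono fun z => ?_
        have h := lintegral_lower_tail_le (gaussianReal 0 (n : ℝ≥0)⁻¹) hm he (hg z)
          (fun x => div_nonneg (Finset.sum_nonneg fun b _ => (lik_pos _ _ _).le) zero_le_two)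
          (tiltMean_pos ha z) (tiltSq_pos ha z) hε (lintegral_average_lik hn ha hμ z)
          (lintegral_average_lik_sq_le hn ha hμ z)
        have h2 : ∀ x : ℝ, ENNReal.ofReal (2 * m * x) = ENNReal.ofReal (2 * m) * ENNReal.ofReal x :=
          fun x => ENNReal.ofReal_mul (by positivity)
        simp_rw [h2, mul_assoc]
        rw [lintegral_const_mul' _ _ ENNReal.ofReal_ne_top,
          ← ENNReal.ofReal_mul (p := 8 / (m ^ 2 * ε ^ 4)) (by positivity)]
        simp only [mul_assoc] at h
        gcongr
    _ ≤ _ := by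
        rw [lintegral_const_mul _ (by fun_prop), ← mul_assoc (2 * (m : ℝ)),
          ENNReal.ofReal_mul (q := Real.exp _) (by positivity)]
        gcongr
        exact lintegral_tiltSq_sq_div_tiltMean_cube_le ha ha'

/-- Bayes risk lower bound for a single spike `±τ` at a uniformly random position of a block. -/
lemma ofReal_le_sum_block_risk (hn : 0 < n) (hm : 0 < m) (he : Function.Injective e)
    (ha : 0 ≤ a) (ha' : a ≤ 1 / 4) (hμ : μ ^ 2 = n * a) (hε : 0 < ε) (hε1 : ε < 1)
    {h : (Fin n → Fin p → ℝ) × (Fin n → ℝ) → Fin m → ℝ} (hh : Measurable h) :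
    ENNReal.ofReal (2 * m * τ ^ 2) ≤
      ∑ i, ∑ b, ∫⁻ ω, ENNReal.ofReal
        (∑ i', (h (ω.1, fun r => ω.2 r + boolSign b * μ * ω.1 r (e i)) i' -
          if i' = i then boolSign b * τ else 0) ^ 2) ∂model n p +
      ENNReal.ofReal (2 * m * τ ^ 2 * gainBound n m a ε) := by
  have hm' : (0 : ℝ) < m := by exact_mod_cast hm
  have hε' : 0 < 1 - ε := by linarith
  have hL := fun t j => measurable_lik_column (n := n) (p := p) t j
  have hd := measurable_tiltMean (n := n) a
  have hs := measurable_tiltSq (n := n) a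
  have hQ : ∀ i b, Measurable fun ω : (Fin n → Fin p → ℝ) × (Fin n → ℝ) => ENNReal.ofReal
      (∑ i', (h ω i' - if i' = i then boolSign b * τ else 0) ^ 2) := fun i b => by
    refine Measurable.ennreal_ofReal (Finset.measurable_sum _ fun i' _ => ?_)
    exact (((measurable_pi_apply i').comp hh).sub_const _).pow_const 2
  set W : (Fin n → Fin p → ℝ) × (Fin n → ℝ) → Fin m → Bool → ℝ :=
    fun ω i b => lik (boolSign b * μ) (fun r => ω.1 r (e i)) ω.2 with hW
  have hW0 : ∀ ω i b, 0 < W ω i b := fun ω i b => lik_pos _ _ _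
  have hWm : ∀ i b, Measurable fun ω => W ω i b := fun i b => hL _ _
  have hQW : ∀ i b, Measurable fun ω => ENNReal.ofReal
      (∑ i', (h ω i' - if i' = i then boolSign b * τ else 0) ^ 2) * ENNReal.ofReal (W ω i b) :=
    fun i b => (hQ i b).mul (hWm i b).ennreal_ofReal
  have : Nonempty (Fin m) := ⟨⟨0, hm⟩⟩
  have hS0 : ∀ ω, 0 < ∑ i, ∑ b, W ω i b := fun ω =>
    Finset.sum_pos (fun i _ => Finset.sum_pos (fun b _ => hW0 ω i b) Finset.univ_nonempty)
      Finset.univ_nonempty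
  set B1 : (Fin n → Fin p → ℝ) × (Fin n → ℝ) → ℝ := fun ω =>
    (∑ i, (W ω i true - W ω i false) ^ 2) / (2 * m * (1 - ε) * tiltMean a ω.2) with hB1
  set B2 : (Fin n → Fin p → ℝ) × (Fin n → ℝ) → ℝ := fun ω =>
    2 * m * (tiltMean a ω.2 * Real.exp (ε * tiltMean a ω.2 / tiltSq a ω.2 *
      ((1 - ε) * m * tiltMean a ω.2 - ∑ i, (∑ b, W ω i b) / 2))) with hB2
  have hB10 : ∀ ω, 0 ≤ B1 ω := fun ω => by
    have := tiltMean_pos ha ω.2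
    positivity
  have hB20 : ∀ ω, 0 ≤ B2 ω := fun ω => by
    have := tiltMean_pos ha ω.2
    positivity
  have hB1m : Measurable B1 :=
    Measurable.div (Finset.measurable_sum _ fun i _ =>
      ((hWm _ _).sub (hWm _ _)).pow_const 2) (by fun_prop)
  have hpt : ∀ ω, ENNReal.ofReal (τ ^ 2) * ∑ i, ∑ b, ENNReal.ofReal (W ω i b) ≤
      ∑ i, ∑ b, ENNReal.ofReal (∑ i', (h ω i' - if i' = i then boolSign b * τ else 0) ^ 2) *
          ENNReal.ofReal (W ω i b) +
        ENNReal.ofReal (τ ^ 2) * (ENNReal.ofReal (B1 ω) + ENNReal.ofReal (B2 ω)) := by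
    intro ω
    have hd0 := tiltMean_pos ha ω.2
    have hs0 := tiltSq_pos ha ω.2
    have h1 := mul_sum_le_sum_sq_add (W ω) (hS0 ω) (h ω) τ
    have h2 := sum_sq_div_sum_le (W ω) (fun i b => (hW0 ω i b).le) (hS0 ω) hd0 hm hε hε1
      (l := ε * tiltMean a ω.2 / tiltSq a ω.2) (by positivity)
    have h3 : τ ^ 2 * ∑ i, ∑ b, W ω i b ≤
        ∑ i, ∑ b, (∑ i', (h ω i' - if i' = i then boolSign b * τ else 0) ^ 2) * W ω i b +
          τ ^ 2 * (B1 ω + B2 ω) := by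
      refine h1.trans ?_
      gcongr
    have hnn : ∀ i b, 0 ≤ (∑ i', (h ω i' - if i' = i then boolSign b * τ else 0) ^ 2) * W ω i b :=
      fun i b => mul_nonneg (Finset.sum_nonneg fun _ _ => sq_nonneg _) (hW0 ω i b).le
    have hq : ∀ i b, ENNReal.ofReal (∑ i', (h ω i' - if i' = i then boolSign b * τ else 0) ^ 2) *
        ENNReal.ofReal (W ω i b) = ENNReal.ofReal
          ((∑ i', (h ω i' - if i' = i then boolSign b * τ else 0) ^ 2) * W ω i b) := fun i b =>
      (ENNReal.ofReal_mul (Finset.sum_nonneg fun _ _ => sq_nonneg _)).symm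
    have hsum : ∀ f : Fin m → Bool → ℝ, (∀ i b, 0 ≤ f i b) →
        ∑ i, ∑ b, ENNReal.ofReal (f i b) = ENNReal.ofReal (∑ i, ∑ b, f i b) := fun f hf => by
      rw [ENNReal.ofReal_sum_of_nonneg fun i _ => Finset.sum_nonneg fun b _ => hf i b]
      exact Finset.sum_congr rfl fun i _ =>
        (ENNReal.ofReal_sum_of_nonneg fun b _ => hf i b).symm
    simp_rw [hq]
    rw [hsum _ fun i b => (hW0 ω i b).le, hsum _ hnn, ← ENNReal.ofReal_mul (by positivity),
      ← ENNReal.ofReal_add (hB10 ω) (hB20 ω), ← ENNReal.ofReal_mul (by positivity),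
      ← ENNReal.ofReal_add (Finset.sum_nonneg fun i _ => Finset.sum_nonneg fun b _ => hnn i b)
        (mul_nonneg (sq_nonneg _) (add_nonneg (hB10 ω) (hB20 ω)))]
    exact ENNReal.ofReal_le_ofReal h3
  have h_int := lintegral_mono (μ := model n p) hpt
  have hsumW : ∫⁻ ω, ∑ i, ∑ b, ENNReal.ofReal (W ω i b) ∂model n p = ENNReal.ofReal (2 * m) := by
    rw [lintegral_finsetSum _ fun i _ => Finset.measurable_sum _ fun b _ => (hWm i b).ennreal_ofReal]
    simp_rw [lintegral_finsetSum Finset.univ fun b _ => (hWm _ b).ennreal_ofReal]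
    simp only [hW, lintegral_model_lik]
    rw [ENNReal.ofReal_mul (by positivity)]
    simp [mul_comm]
  rw [lintegral_const_mul' _ _ ENNReal.ofReal_ne_top, hsumW,
    lintegral_add_left (Finset.measurable_sum _ fun i _ => Finset.measurable_sum _ fun b _ =>
      hQW i b),
    lintegral_const_mul' _ _ ENNReal.ofReal_ne_top, lintegral_add_left hB1m.ennreal_ofReal,
    lintegral_finsetSum _ fun i _ => Finset.measurable_sum _ fun b _ =>
      hQW i b] at h_int
  simp_rw [lintegral_finsetSum Finset.univ fun b _ => hQW _ b] at h_int
  have hshift : ∀ i b, ∫⁻ ω, ENNReal.ofReal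
        (∑ i', (h ω i' - if i' = i then boolSign b * τ else 0) ^ 2) *
          ENNReal.ofReal (W ω i b) ∂model n p =
      ∫⁻ ω, ENNReal.ofReal
        (∑ i', (h (ω.1, fun r => ω.2 r + boolSign b * μ * ω.1 r (e i)) i' -
          if i' = i then boolSign b * τ else 0) ^ 2) ∂model n p := fun i b =>
    (lintegral_model_shift (boolSign b * μ) (e i) (hQ i b)).symm
  simp_rw [hshift] at h_int
  calc ENNReal.ofReal (2 * m * τ ^ 2) = ENNReal.ofReal (τ ^ 2) * ENNReal.ofReal (2 * m) := by
        rw [← ENNReal.ofReal_mul (by positivity), mul_comm]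
    _ ≤ _ := h_int
    _ ≤ _ := by
        gcongr
        calc _ ≤ ENNReal.ofReal (τ ^ 2) *
              (ENNReal.ofReal (2 * m * ((1 + a) ^ n / (2 * m * (1 - ε)))) +
                ENNReal.ofReal (2 * m * (8 / (m ^ 2 * ε ^ 4) * Real.exp (4 * (n * a))))) := by
              gcongr
              · exact lintegral_posterior_gain_main_le hn hm ha hμ hε1
              · exact lintegral_posterior_gain_tail_le hn hm he ha ha' hμ hε
          _ = _ := by
              rw [← ENNReal.ofReal_add (by positivity) (by positivity),
                ← ENNReal.ofReal_mul (by positivity)]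
              congr 1
              rw [gainBound]
              ring

end BlockRisk

section Packing

variable {n p k m : ℕ} {pos : Fin k → Fin m → Fin p} {a τ σ ε : ℝ}

/-- The sparse vector with one spike of height `±τ` in each of `k` disjoint blocks. -/
def spikes (pos : Fin k → Fin m → Fin p) (τ : ℝ) (c : Fin k → Fin m × Bool) (j : Fin p) : ℝ :=
  ∑ b, if pos b (c b).1 = j then boolSign (c b).2 * τ else 0

lemma sum_mul_spikes (f : Fin p → ℝ) (c : Fin k → Fin m × Bool) :
    ∑ j, f j * spikes pos τ c j = ∑ b, f (pos b (c b).1) * (boolSign (c b).2 * τ) := by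
  simp only [spikes, Finset.mul_sum, mul_ite, mul_zero]
  rw [Finset.sum_comm]
  simp

lemma spikes_pos (hpos : Function.Injective2 pos) (c : Fin k → Fin m × Bool) (b : Fin k)
    (i : Fin m) :
    spikes pos τ c (pos b i) = if i = (c b).1 then boolSign (c b).2 * τ else 0 := by
  rw [spikes, Finset.sum_eq_single b]
  · simp only [hpos.eq_iff, true_and, eq_comm]
  · intro b' _ hb
    simp [hpos.eq_iff, hb]
  · simp

lemma spikes_mem_Theta (hpos : Function.Injective2 pos) (c : Fin k → Fin m × Bool) :
    spikes pos τ c ∈ Theta p k τ := by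
  constructor
  · have hsub : (Finset.univ.filter fun j => spikes pos τ c j ≠ 0) ⊆
        Finset.univ.image fun b => pos b (c b).1 := by
      intro j hj
      obtain ⟨b, -, hb⟩ := Finset.exists_ne_zero_of_sum_ne_zero (Finset.mem_filter.1 hj).2
      exact Finset.mem_image.2 ⟨b, Finset.mem_univ b, by by_contra hne; simp [hne] at hb⟩
    exact (Finset.card_le_card hsub).trans (Finset.card_image_le.trans (by simp))
  · refine le_of_eq ?_
    simp_rw [sq (spikes pos τ c _)]
    rw [sum_mul_spikes]
    simp_rw [spikes_pos hpos]
    simp [← sq, mul_pow, boolSign_sq]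

/-- Averaging over all configurations is unaffected by resampling one coordinate. -/
lemma sum_sum_update {ι C M : Type*} [Fintype ι] [DecidableEq ι] [Fintype C]
    [AddCommMonoid M] (F : (ι → C) → M) (b : ι) :
    ∑ c, ∑ x, F (Function.update c b x) = Fintype.card C • ∑ c, F c := by
  have hinv : Function.Involutive fun y : (ι → C) × C => (Function.update y.1 b y.2, y.1 b) := by
    rintro ⟨c, x⟩
    simp
  rw [← Fintype.sum_prod_type' fun c x => F (Function.update c b x),
    Fintype.sum_equiv hinv.toPerm (fun y => F (Function.update y.1 b y.2)) (fun y => F y.1)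
      fun y => rfl,
    Fintype.sum_prod_type, ← Finset.sum_nsmul]
  simp

/-- Contribution of block `b` to the risk at the configuration `c`. -/
def blockRisk (n : ℕ) (pos : Fin k → Fin m → Fin p) (τ σ : ℝ)
    (est : (Fin n → Fin p → ℝ) × (Fin n → ℝ) → Fin p → ℝ) (b : Fin k)
    (c : Fin k → Fin m × Bool) : ℝ≥0∞ :=
  ∫⁻ ω, ENNReal.ofReal (∑ i, (est (ω.1, fun r => (∑ l, ω.1 r l * spikes pos τ c l) + σ * ω.2 r)
    (pos b i) - spikes pos τ c (pos b i)) ^ 2) ∂model n p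

variable {est : (Fin n → Fin p → ℝ) × (Fin n → ℝ) → Fin p → ℝ}

lemma sum_blockRisk_le_risk (hpos : Function.Injective2 pos) (hest : Measurable est)
    (c : Fin k → Fin m × Bool) :
    ∑ b, blockRisk n pos τ σ est b c ≤ risk n p σ est (spikes pos τ c) := by
  have hdata : Measurable fun ω : (Fin n → Fin p → ℝ) × (Fin n → ℝ) =>
      (ω.1, fun r => (∑ l, ω.1 r l * spikes pos τ c l) + σ * ω.2 r) := by fun_prop
  have hm : ∀ b, Measurable fun ω : (Fin n → Fin p → ℝ) × (Fin n → ℝ) => ENNReal.ofReal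
      (∑ i, (est (ω.1, fun r => (∑ l, ω.1 r l * spikes pos τ c l) + σ * ω.2 r)
        (pos b i) - spikes pos τ c (pos b i)) ^ 2) := fun b =>
    (Finset.measurable_sum _ fun i _ => (((measurable_pi_apply (pos b i)).comp
      (hest.comp hdata)).sub_const _).pow_const 2).ennreal_ofReal
  simp only [blockRisk]
  rw [← lintegral_finsetSum _ fun b _ => hm b, risk]
  refine lintegral_mono fun ω => ?_
  rw [← ENNReal.ofReal_sum_of_nonneg fun _ _ => Finset.sum_nonneg fun _ _ => sq_nonneg _]
  refine ENNReal.ofReal_le_ofReal ?_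
  set f : Fin p → ℝ := fun j =>
    (est (ω.1, fun r => (∑ l, ω.1 r l * spikes pos τ c l) + σ * ω.2 r) j - spikes pos τ c j) ^ 2
  have hinj : Function.Injective fun y : Fin k × Fin m => pos y.1 y.2 := fun y y' h =>
    Prod.ext (hpos h).1 (hpos h).2
  calc ∑ b, ∑ i, f (pos b i) = ∑ j ∈ Finset.univ.map ⟨_, hinj⟩, f j := by
        rw [Finset.sum_map, Fintype.sum_prod_type]
        rfl
    _ ≤ ∑ j, f j := Finset.sum_le_sum_of_subset_of_nonneg (Finset.subset_univ _)
        fun _ _ _ => sq_nonneg _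

lemma ofReal_le_sum_blockRisk_update (hpos : Function.Injective2 pos) (hest : Measurable est)
    (hn : 0 < n) (hm : 0 < m) (ha : 0 ≤ a) (ha' : a ≤ 1 / 4) (hσ : 0 < σ)
    (hμ : (τ / σ) ^ 2 = n * a) (hε : 0 < ε) (hε1 : ε < 1) (b : Fin k)
    (c : Fin k → Fin m × Bool) :
    ENNReal.ofReal (2 * m * τ ^ 2) ≤
      ∑ x, blockRisk n pos τ σ est b (Function.update c b x) +
        ENNReal.ofReal (2 * m * τ ^ 2 * gainBound n m a ε) := by
  set h : (Fin n → Fin p → ℝ) × (Fin n → ℝ) → Fin m → ℝ := fun ω i =>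
    est (ω.1, fun r => (∑ b' ∈ Finset.univ.erase b,
      ω.1 r (pos b' (c b').1) * (boolSign (c b').2 * τ)) + σ * ω.2 r) (pos b i) with hh
  have hdata : Measurable fun ω : (Fin n → Fin p → ℝ) × (Fin n → ℝ) =>
      (ω.1, fun r => (∑ b' ∈ Finset.univ.erase b,
        ω.1 r (pos b' (c b').1) * (boolSign (c b').2 * τ)) + σ * ω.2 r) := by fun_prop
  have hhm : Measurable h := measurable_pi_lambda _ fun i =>
    (measurable_pi_apply (pos b i)).comp (hest.comp hdata)
  have hinj : Function.Injective (pos b) := fun i i' hi => (hpos hi).2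
  refine (ofReal_le_sum_block_risk hn hm hinj ha ha' hμ hε hε1 (τ := τ) hhm).trans_eq ?_
  rw [Fintype.sum_prod_type]
  congr 1
  refine Finset.sum_congr rfl fun i _ => Finset.sum_congr rfl fun s _ => ?_
  refine lintegral_congr fun ω => ?_
  have hdata_eq : (fun r => (∑ b' ∈ Finset.univ.erase b,
        ω.1 r (pos b' (c b').1) * (boolSign (c b').2 * τ)) +
          σ * (ω.2 r + boolSign s * (τ / σ) * ω.1 r (pos b i))) =
      fun r => (∑ l, ω.1 r l * spikes pos τ (Function.update c b (i, s)) l) + σ * ω.2 r := by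
    funext r
    have hrest : ∑ b' ∈ Finset.univ.erase b,
          ω.1 r (pos b' (c b').1) * (boolSign (c b').2 * τ) =
        ∑ b' ∈ Finset.univ.erase b, ω.1 r (pos b' (Function.update c b (i, s) b').1) *
          (boolSign (Function.update c b (i, s) b').2 * τ) :=
      Finset.sum_congr rfl fun b' hb' => by
        rw [Function.update_of_ne (Finset.ne_of_mem_erase hb')]
    rw [sum_mul_spikes, ← Finset.sum_erase_add _ _ (Finset.mem_univ b), Function.update_self,
      hrest, mul_add]
    have hscale : σ * (boolSign s * (τ / σ) * ω.1 r (pos b i)) =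
        ω.1 r (pos b i) * (boolSign s * τ) := by
      field_simp
    rw [hscale]
    ring
  simp only [spikes_pos hpos, Function.update_self, hh, hdata_eq]

lemma ofReal_le_iSup_risk_add (hpos : Function.Injective2 pos) (hest : Measurable est)
    (hn : 0 < n) (hm : 0 < m) (ha : 0 ≤ a) (ha' : a ≤ 1 / 4) (hσ : 0 < σ)
    (hμ : (τ / σ) ^ 2 = n * a) (hε : 0 < ε) (hε1 : ε < 1) :
    ENNReal.ofReal (k * τ ^ 2) ≤ (⨆ β ∈ Theta p k τ, risk n p σ est β) +
      ENNReal.ofReal (k * τ ^ 2 * gainBound n m a ε) := by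
  set S := ⨆ β ∈ Theta p k τ, risk n p σ est β
  have hle : ∀ c : Fin k → Fin m × Bool, ∑ b, blockRisk n pos τ σ est b c ≤ S := fun c =>
    (sum_blockRisk_le_risk hpos hest c).trans
      (le_iSup₂ (f := fun β (_ : β ∈ Theta p k τ) => risk n p σ est β) _
        (spikes_mem_Theta hpos c))
  have hsum := Finset.sum_le_sum fun c (_ : c ∈ (Finset.univ : Finset (Fin k → Fin m × Bool))) =>
    Finset.sum_le_sum fun b (_ : b ∈ (Finset.univ : Finset (Fin k))) =>
      ofReal_le_sum_blockRisk_update hpos hest hn hm ha ha' hσ hμ hε hε1 b c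
  simp only [Finset.sum_add_distrib] at hsum
  rw [Finset.sum_comm (f := fun c b => ∑ x, blockRisk n pos τ σ est b (Function.update c b x))]
    at hsum
  simp_rw [sum_sum_update] at hsum
  rw [← Finset.smul_sum, Finset.sum_comm (f := fun b c => blockRisk n pos τ σ est b c)] at hsum
  have hsum' := hsum.trans (add_le_add_left
    (nsmul_le_nsmul_right (Finset.sum_le_sum fun c _ => hle c) _) _)
  have : Nonempty (Fin m) := ⟨⟨0, hm⟩⟩
  set N : ℝ≥0∞ := (Fintype.card (Fin k → Fin m × Bool) : ℝ≥0∞) with hN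
  have hN0 : N ≠ 0 := by simp [hN, hm.ne']
  have hNt : N ≠ ⊤ := ENNReal.natCast_ne_top _
  have hfac : ∀ x : ℝ, ENNReal.ofReal (2 * m * x) = 2 * m * ENNReal.ofReal x := fun x => by
    rw [ENNReal.ofReal_mul (by positivity), ENNReal.ofReal_mul (by positivity)]
    simp
  have hfack : ∀ x : ℝ, ENNReal.ofReal (k * x) = k * ENNReal.ofReal x := fun x => by
    rw [ENNReal.ofReal_mul (by positivity)]
    simp
  have h2m0 : (2 * m : ℝ≥0∞) ≠ 0 := by simp [hm.ne']
  have h2mt : (2 * m : ℝ≥0∞) ≠ ⊤ := ENNReal.mul_ne_top (by simp) (by simp)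
  simp only [mul_assoc _ (τ ^ 2), hfac, Finset.sum_const, Finset.card_univ, Fintype.card_prod,
    Fintype.card_fin, Fintype.card_bool, nsmul_eq_mul, Nat.cast_mul, Nat.cast_ofNat, ← hN]
    at hsum'
  rw [mul_assoc _ (τ ^ 2), hfack, hfack]
  rw [← ENNReal.mul_le_mul_iff_right (mul_ne_zero hN0 h2m0) (ENNReal.mul_ne_top hNt h2mt)]
  calc _ = N * (k * (2 * m * ENNReal.ofReal (τ ^ 2))) := by ring
    _ ≤ _ := hsum'
    _ = _ := by ring

/-- Non-asymptotic minimax lower bound. -/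
lemma ofReal_le_minimaxRisk_add (hkm : k * m ≤ p)
    (hn : 0 < n) (hm : 0 < m) (ha : 0 ≤ a) (ha' : a ≤ 1 / 4) (hσ : 0 < σ)
    (hμ : (τ / σ) ^ 2 = n * a) (hε : 0 < ε) (hε1 : ε < 1) :
    ENNReal.ofReal (k * τ ^ 2) ≤ minimaxRisk n p k τ σ +
      ENNReal.ofReal (k * τ ^ 2 * gainBound n m a ε) := by
  have hpos : Function.Injective2 fun (b : Fin k) (i : Fin m) =>
      Fin.castLE hkm (finProdFinEquiv (b, i)) := fun b b' i i' h => by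
    simpa using finProdFinEquiv.injective (Fin.castLE_injective hkm h)
  rw [← tsub_le_iff_right]
  unfold _root_.minimaxRisk
  refine le_iInf₂ fun est hest => tsub_le_iff_right.2 ?_
  exact ofReal_le_iSup_risk_add hpos hest hn hm ha ha' hσ hμ hε hε1

lemma minimaxRisk_le : minimaxRisk n p k τ σ ≤ ENNReal.ofReal (k * τ ^ 2) := by
  refine (iInf₂_le (fun _ _ => 0) measurable_const).trans (iSup₂_le fun β hβ => ?_)
  simp only [risk, zero_sub, neg_sq, lintegral_const, measure_univ, mul_one]
  exact ENNReal.ofReal_le_ofReal hβ.2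

lemma one_sub_minimaxRisk_div_le (hk : 0 < k) (hkm : k * m ≤ p) (hτ : 0 < τ)
    (hn : 0 < n) (hm : 0 < m) (ha : 0 ≤ a) (ha' : a ≤ 1 / 4) (hσ : 0 < σ)
    (hμ : (τ / σ) ^ 2 = n * a) (hε : 0 < ε) (hε1 : ε < 1) :
    1 - (minimaxRisk n p k τ σ).toReal / (k * τ ^ 2) ≤ gainBound n m a ε := by
  have hk' : (0 : ℝ) < k := by exact_mod_cast hk
  have hε' : 0 < 1 - ε := by linarith
  have hg : 0 ≤ gainBound n m a ε := by rw [gainBound]; positivity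
  have hfin : minimaxRisk n p k τ σ ≠ ⊤ := (minimaxRisk_le.trans_lt ENNReal.ofReal_lt_top).ne
  have h := ENNReal.toReal_mono (ENNReal.add_ne_top.2 ⟨hfin, ENNReal.ofReal_ne_top⟩)
    (ofReal_le_minimaxRisk_add hkm hn hm ha ha' hσ hμ hε hε1)
  rw [ENNReal.toReal_add hfin ENNReal.ofReal_ne_top, ENNReal.toReal_ofReal (by positivity),
    ENNReal.toReal_ofReal (by positivity)] at h
  rw [sub_le_iff_le_add, ← sub_le_iff_le_add', le_div_iff₀ (by positivity)]
  linarith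

lemma one_sub_minimaxRisk_div_nonneg :
    0 ≤ 1 - (minimaxRisk n p k τ σ).toReal / (k * τ ^ 2) := by
  have h := ENNReal.toReal_mono ENNReal.ofReal_ne_top
    (minimaxRisk_le (n := n) (p := p) (k := k) (τ := τ) (σ := σ))
  rw [ENNReal.toReal_ofReal (by positivity)] at h
  exact sub_nonneg.2 (div_le_one_of_le₀ h (by positivity))

end Packing

lemma gainBound_mul_le {n m : ℕ} {a ε r : ℝ} (hm : 0 < m) (ha : 0 ≤ a) (hε : 0 < ε)
    (hε1 : ε < 1) (hr : 0 < r) :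
    gainBound n m a ε * (2 * r / Real.exp (n * a)) ≤
      r / m / (1 - ε) + 16 / ε ^ 4 * (r / m) ^ 2 * (Real.exp (3 * (n * a)) / r) := by
  have hm' : (0 : ℝ) < m := by exact_mod_cast hm
  have hε' : 0 < 1 - ε := by linarith
  have hpow : (1 + a) ^ n ≤ Real.exp (n * a) := by
    rw [Real.exp_nat_mul]
    exact pow_le_pow_left₀ (by positivity) (by linarith [Real.add_one_le_exp a]) n
  have hexp : Real.exp (4 * (n * a)) = Real.exp (3 * (n * a)) * Real.exp (n * a) := by
    rw [← Real.exp_add]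
    ring_nf
  calc _ ≤ (Real.exp (n * a) / (2 * m * (1 - ε)) + 8 / (m ^ 2 * ε ^ 4) *
        (Real.exp (3 * (n * a)) * Real.exp (n * a))) * (2 * r / Real.exp (n * a)) := by
        rw [gainBound, hexp]
        gcongr
    _ = _ := by
        field_simp
        ring

lemma tendsto_exp_mul_sq_div_zero {μ r : ℕ → ℝ} (hr : Tendsto r atTop atTop)
    (hμ : Tendsto (fun n => μ n / √(Real.log (r n))) atTop (nhds 0)) :
    Tendsto (fun n => Real.exp (3 * μ n ^ 2) / r n) atTop (nhds 0) := by
  have hlog : Tendsto (fun n => Real.log (r n)) atTop atTop := Real.tendsto_log_atTop.comp hr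
  have hsq : Tendsto (fun n => (μ n / √(Real.log (r n))) ^ 2) atTop (nhds 0) := by
    simpa using hμ.pow 2
  have hlim : Tendsto (fun n => Real.exp (-(1 / 2 * Real.log (r n)))) atTop (nhds 0) :=
    Real.tendsto_exp_neg_atTop_nhds_zero.comp (hlog.const_mul_atTop (by norm_num))
  refine squeeze_zero' ?_ ?_ hlim
  · filter_upwards [hr.eventually_gt_atTop 0] with n hn
    positivity
  · filter_upwards [hr.eventually_gt_atTop 0, hlog.eventually_gt_atTop 0,
      hsq.eventually_lt_const (show (0 : ℝ) < 1 / 6 by norm_num)] with n hn hln hs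
    rw [div_pow, Real.sq_sqrt hln.le, div_lt_iff₀ hln] at hs
    calc _ = Real.exp (3 * μ n ^ 2 - Real.log (r n)) := by rw [Real.exp_sub, Real.exp_log hn]
      _ ≤ _ := Real.exp_le_exp.2 (by linarith)

/-- **Theorem 4(i) (second-order minimax lower bound in Regime II).** If `k/p → 0`,
`μ = τ/σ → ∞`, `μ = o(√(log(p/k)))`, `(log(p/k))/n → 0` and `τ⁴/(n σ⁴) → 0`, then
`R(Θ(k,τ),σ) ≥ k τ² (1 − ((1+o(1))/2) (k/p) e^{τ²/σ²})`, i.e.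
`limsup (1 − R/(k τ²)) · (2p/(k e^{μ²})) ≤ 1`. -/
theorem regimeII_second_order_minimax_lower
    (k p : ℕ → ℕ) (τ σ : ℕ → ℝ)
    (hk : ∀ n, 0 < k n) (hkp : ∀ n, k n ≤ p n)
    (hτ : ∀ n, 0 < τ n) (hσ : ∀ n, 0 < σ n)
    (hkp0 : Tendsto (fun n => (k n : ℝ) / p n) atTop (nhds 0))
    (hμ : Tendsto (fun n => τ n / σ n) atTop atTop)
    (hμo : Tendsto (fun n => (τ n / σ n) / Real.sqrt (Real.log ((p n : ℝ) / k n)))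
      atTop (nhds 0))
    (hlog : Tendsto (fun n => Real.log ((p n : ℝ) / k n) / n) atTop (nhds 0))
    (hτ4 : Tendsto (fun n => τ n ^ 4 / (n * σ n ^ 4)) atTop (nhds 0)) :
    Filter.limsup (fun n =>
        (1 - (minimaxRisk n (p n) (k n) (τ n) (σ n)).toReal / (k n * τ n ^ 2)) *
          (2 * p n / (k n * Real.exp ((τ n / σ n) ^ 2)))) atTop ≤ 1 := by
  set μ : ℕ → ℝ := fun n => τ n / σ n with hμdef
  set r : ℕ → ℝ := fun n => (p n : ℝ) / k n with hrdef
  set m : ℕ → ℕ := fun n => p n / k n with hmdef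
  have hk' : ∀ n, (0 : ℝ) < k n := fun n => by exact_mod_cast hk n
  have hp' : ∀ n, (0 : ℝ) < p n := fun n => by exact_mod_cast (hk n).trans_le (hkp n)
  have hr0 : ∀ n, 0 < r n := fun n => div_pos (hp' n) (hk' n)
  have hm0 : ∀ n, 0 < m n := fun n => Nat.div_pos (hkp n) (hk n)
  have hr : Tendsto r atTop atTop := by
    have h : Tendsto (fun n => (k n : ℝ) / p n) atTop (nhdsWithin 0 (Set.Ioi 0)) :=
      tendsto_nhdsWithin_iff.2 ⟨hkp0, Eventually.of_forall fun n => div_pos (hk' n) (hp' n)⟩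
    refine h.inv_tendsto_nhdsGT_zero.congr fun n => ?_
    simp [hrdef]
  have hrm : Tendsto (fun n => r n / m n) atTop (nhds 1) := by
    have h := ((tendsto_nat_floor_div_atTop (R := ℝ)).comp hr).inv₀ one_ne_zero
    simpa [Function.comp_def, hrdef, hmdef, Nat.floor_div_eq_div] using h
  have hexp := tendsto_exp_mul_sq_div_zero hr hμo
  have ha : Tendsto (fun n => μ n ^ 2 / n) atTop (nhds 0) := by
    refine squeeze_zero' (Eventually.of_forall fun n => by positivity) ?_ hτ4
    filter_upwards [hμ.eventually_ge_atTop 1] with n hn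
    have h : τ n ^ 4 / (n * σ n ^ 4) = μ n ^ 4 / n := by
      rw [hμdef, div_pow, div_div, mul_comm (n : ℝ)]
    rw [h]
    gcongr 1
    exact pow_le_pow_right₀ hn (by norm_num)
  refine le_of_forall_pos_le_add fun δ hδ => ?_
  obtain ⟨ε, hε, hε1, hεδ⟩ : ∃ ε : ℝ, 0 < ε ∧ ε < 1 ∧ 1 / (1 - ε) < 1 + δ := by
    refine ⟨δ / (2 * (1 + δ)), by positivity, ?_, ?_⟩
    · rw [div_lt_one (by positivity)]
      linarith
    · have h : 1 - δ / (2 * (1 + δ)) = (2 + δ) / (2 * (1 + δ)) := by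
        field_simp
        ring
      rw [h, one_div_div, div_lt_iff₀ (by positivity)]
      nlinarith
  have hlim : Tendsto (fun n => r n / m n / (1 - ε) +
      16 / ε ^ 4 * (r n / m n) ^ 2 * (Real.exp (3 * μ n ^ 2) / r n)) atTop
      (nhds (1 / (1 - ε))) := by
    simpa using (hrm.div_const (1 - ε)).add (((hrm.pow 2).const_mul (16 / ε ^ 4)).mul hexp)
  refine limsup_le_of_le (isCoboundedUnder_le_of_le atTop (x := 0) fun n =>
    mul_nonneg one_sub_minimaxRisk_div_nonneg (by positivity)) ?_
  filter_upwards [hlim.eventually_lt_const hεδ, ha.eventually_lt_const (show (0 : ℝ) < 1 / 4 by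
    norm_num), eventually_gt_atTop 0] with n hlt han hn
  have hn' : (n : ℝ) ≠ 0 := by exact_mod_cast hn.ne'
  have hna : n * (μ n ^ 2 / n) = μ n ^ 2 := mul_div_cancel₀ _ hn'
  have hbound := gainBound_mul_le (n := n) (a := μ n ^ 2 / n) (hm0 n) (by positivity) hε hε1
    (hr0 n)
  rw [hna] at hbound
  refine le_trans ?_ (hbound.trans hlt.le)
  rw [← div_div (2 * (p n : ℝ)), mul_div_assoc (2 : ℝ)]
  exact mul_le_mul_of_nonneg_right (one_sub_minimaxRisk_div_le (hk n) (Nat.mul_div_le _ _) (hτ n) hn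
    (hm0 n) (by positivity) han.le (hσ n) hna.symm hε hε1) (by have := hr0 n; positivity)
end
end
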